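/- arXiv:1701.03195 — 5 statements merged into one kernel-verified Lean document; each statement's English description precedes it below -/
import Mathlib

section
/- Wolfowitz-type strong converse for binary quantum hypothesis testing against a tensor power: Let X be a finite alphabet, W̄ : X → density operators on ℂ^d a classical-quantum channel, σ a positive definite density operator on ℂ^d, x^n ∈ X^n, R ∈ ℝ, and κ > 0. Set A := max_{x∈X} V(W̄_x‖σ). Then for any test Q_n on (ℂ^d)^{⊗n} (i.e., 0 ≤ Q_n ≤ 1) with Tr[Q_n σ^{⊗n}] ≤ exp(−nR) and (1/n)·Σ_{i=1}^n D(W̄_{x_i}‖σ) ≤ R − 2κ, one has Tr[(1 − Q_n)·W̄_{x^n}] ≥ 1 − A/(n·κ²) − exp(−n·κ), where W̄_{x^n} := W̄_{x_1} ⊗ ⋯ ⊗ W̄_{x_n}. -/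
open scoped BigOperators ComplexOrder
open Filter

noncomputable section

namespace MDQ

/-- Functional calculus for Hermitian matrices (junk value `0` otherwise). -/
noncomputable def matFun {d : ℕ} (f : ℝ → ℝ) (A : Matrix (Fin d) (Fin d) ℂ) :
    Matrix (Fin d) (Fin d) ℂ :=
  if hA : A.IsHermitian then hA.cfc f else 0

/-- Matrix logarithm on the support (`Real.log 0 = 0`). -/
noncomputable def mlog {d : ℕ} (A : Matrix (Fin d) (Fin d) ℂ) : Matrix (Fin d) (Fin d) ℂ :=
  matFun Real.log A

/-- Matrix real power, restricted to the support. -/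
noncomputable def mpow {d : ℕ} (A : Matrix (Fin d) (Fin d) ℂ) (p : ℝ) :
    Matrix (Fin d) (Fin d) ℂ :=
  matFun (fun t => if t = 0 then 0 else t ^ p) A

/-- Matrix exponential via functional calculus. -/
noncomputable def mexp {d : ℕ} (A : Matrix (Fin d) (Fin d) ℂ) : Matrix (Fin d) (Fin d) ℂ :=
  matFun Real.exp A

/-- Orthogonal projection onto the support of a Hermitian matrix. -/
noncomputable def suppProj {d : ℕ} (A : Matrix (Fin d) (Fin d) ℂ) : Matrix (Fin d) (Fin d) ℂ :=
  matFun (fun t => if t = 0 then 0 else 1) A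

/-- `A` is a density operator. -/
def IsDensity {d : ℕ} (A : Matrix (Fin d) (Fin d) ℂ) : Prop :=
  A.PosSemidef ∧ A.trace = 1

/-- Real part of the trace. -/
noncomputable def reTr {ι : Type} [Fintype ι] (A : Matrix ι ι ℂ) : ℝ :=
  A.trace.re

/-- supp ρ ⊆ supp σ, phrased via ranges of the associated linear maps. -/
def SuppLE {d : ℕ} (ρ σ : Matrix (Fin d) (Fin d) ℂ) : Prop :=
  LinearMap.range (Matrix.toLin' ρ) ≤ LinearMap.range (Matrix.toLin' σ)

/-- Quantum relative entropy `D(ρ‖σ)`. -/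
noncomputable def qD {d : ℕ} (ρ σ : Matrix (Fin d) (Fin d) ℂ) : ℝ :=
  reTr (ρ * (mlog ρ - mlog σ))

/-- Quantum relative entropy variance `V(ρ‖σ)`. -/
noncomputable def qV {d : ℕ} (ρ σ : Matrix (Fin d) (Fin d) ℂ) : ℝ :=
  reTr (ρ * (mlog ρ - mlog σ) ^ 2) - (qD ρ σ) ^ 2

/-- The variant relative entropy variance `Ṽ(ρ‖σ)`. -/
noncomputable def qVtilde {d : ℕ} (ρ σ : Matrix (Fin d) (Fin d) ℂ) : ℝ :=
  (∫ t in (0:ℝ)..1,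
    reTr (mpow ρ (1 - t) * (mlog ρ - mlog σ) * mpow ρ t * (mlog ρ - mlog σ))) - (qD ρ σ) ^ 2

/-- The quantum Rényi divergence of order zero, `D₀(ρ‖σ) = -log Tr[Π_ρ σ]`. -/
noncomputable def qD0 {d : ℕ} (ρ σ : Matrix (Fin d) (Fin d) ℂ) : ℝ :=
  - Real.log (reTr (suppProj ρ * σ))

/-- Tensor product of a finite family of `d × d` matrices. -/
noncomputable def tensorSeq {d n : ℕ} (A : Fin n → Matrix (Fin d) (Fin d) ℂ) :
    Matrix (Fin n → Fin d) (Fin n → Fin d) ℂ :=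
  Matrix.of fun i j => ∏ k, A k (i k) (j k)

/-- `n`-fold tensor power of a matrix. -/
noncomputable def tensorPow {d : ℕ} (A : Matrix (Fin d) (Fin d) ℂ) (n : ℕ) :
    Matrix (Fin n → Fin d) (Fin n → Fin d) ℂ :=
  tensorSeq (fun _ => A)

/-- Smallest type-I error with type-II error at most `μ`:  `α̂_μ(ρ‖σ)`. -/
noncomputable def hypoErr {ι : Type} [Fintype ι] [DecidableEq ι]
    (ρ σ : Matrix ι ι ℂ) (μ : ℝ) : ℝ :=
  sInf { a : ℝ | ∃ Q : Matrix ι ι ℂ, Q.PosSemidef ∧ (1 - Q).PosSemidef ∧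
    reTr (Q * σ) ≤ μ ∧ a = reTr ((1 - Q) * ρ) }

/-- `P` is a probability distribution on a finite alphabet. -/
def IsProbDist {X : Type} [Fintype X] (P : X → ℝ) : Prop :=
  (∀ x, 0 ≤ P x) ∧ ∑ x, P x = 1

/-- The average output state `PW`. -/
noncomputable def avgState {X : Type} [Fintype X] {d : ℕ}
    (P : X → ℝ) (W : X → Matrix (Fin d) (Fin d) ℂ) : Matrix (Fin d) (Fin d) ℂ :=
  ∑ x, (P x : ℂ) • W x

/-- Mutual information `I(P, W)`. -/
noncomputable def mutualInfo {X : Type} [Fintype X] {d : ℕ}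
    (P : X → ℝ) (W : X → Matrix (Fin d) (Fin d) ℂ) : ℝ :=
  ∑ x, P x * qD (W x) (avgState P W)

/-- Capacity `C_W`. -/
noncomputable def capacity {X : Type} [Fintype X] {d : ℕ}
    (W : X → Matrix (Fin d) (Fin d) ℂ) : ℝ :=
  sSup { c : ℝ | ∃ P : X → ℝ, IsProbDist P ∧ c = mutualInfo P W }

/-- Conditional information variance `V(P, W)`. -/
noncomputable def infoVar {X : Type} [Fintype X] {d : ℕ}
    (P : X → ℝ) (W : X → Matrix (Fin d) (Fin d) ℂ) : ℝ :=
  ∑ x, P x * qV (W x) (avgState P W)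

/-- The variant conditional information variance `Ṽ(P, W)`. -/
noncomputable def infoVarTilde {X : Type} [Fintype X] {d : ℕ}
    (P : X → ℝ) (W : X → Matrix (Fin d) (Fin d) ℂ) : ℝ :=
  ∑ x, P x * qVtilde (W x) (avgState P W)

/-- Minimal peripheral information variance `V_W`. -/
noncomputable def Vmin {X : Type} [Fintype X] {d : ℕ}
    (W : X → Matrix (Fin d) (Fin d) ℂ) : ℝ :=
  sInf { v : ℝ | ∃ P : X → ℝ, IsProbDist P ∧ mutualInfo P W = capacity W ∧ v = infoVar P W }

/-- Minimal variant peripheral information variance `Ṽ_W`. -/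
noncomputable def VminTilde {X : Type} [Fintype X] {d : ℕ}
    (W : X → Matrix (Fin d) (Fin d) ℂ) : ℝ :=
  sInf { v : ℝ | ∃ P : X → ℝ, IsProbDist P ∧ mutualInfo P W = capacity W ∧ v = infoVarTilde P W }

/-- Conditional relative entropy `D(W‖σ|P)`. -/
noncomputable def Dcond {X : Type} [Fintype X] {d : ℕ}
    (W : X → Matrix (Fin d) (Fin d) ℂ) (σ : Matrix (Fin d) (Fin d) ℂ) (P : X → ℝ) : ℝ :=
  ∑ x, P x * qD (W x) σ

/-- Conditional relative entropy variance `V(W‖σ|P)`. -/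
noncomputable def Vcond {X : Type} [Fintype X] {d : ℕ}
    (W : X → Matrix (Fin d) (Fin d) ℂ) (σ : Matrix (Fin d) (Fin d) ℂ) (P : X → ℝ) : ℝ :=
  ∑ x, P x * qV (W x) σ

/-- Conditional order-zero Rényi divergence `D₀(W‖σ|P)`. -/
noncomputable def D0cond {X : Type} [Fintype X] {d : ℕ}
    (W : X → Matrix (Fin d) (Fin d) ℂ) (σ : Matrix (Fin d) (Fin d) ℂ) (P : X → ℝ) : ℝ :=
  ∑ x, P x * qD0 (W x) σ

/-- The exponent function `E_h(s, P, σ)`. -/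
noncomputable def Eh {X : Type} [Fintype X] {d : ℕ}
    (W : X → Matrix (Fin d) (Fin d) ℂ) (s : ℝ) (P : X → ℝ)
    (σ : Matrix (Fin d) (Fin d) ℂ) : ℝ :=
  -(1 + s) * ∑ x, P x * Real.log (reTr (mpow (W x) (1 / (1 + s)) * mpow σ (s / (1 + s))))

/-- The log-Euclidean exponent function `Ẽ_h(s, P, σ)`. -/
noncomputable def EhTilde {X : Type} [Fintype X] {d : ℕ}
    (W : X → Matrix (Fin d) (Fin d) ℂ) (s : ℝ) (P : X → ℝ)
    (σ : Matrix (Fin d) (Fin d) ℂ) : ℝ :=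
  -(1 + s) * ∑ x, P x *
    Real.log (reTr (mexp ((((1 + s)⁻¹ : ℝ) : ℂ) • (mlog (W x) + ((s : ℝ) : ℂ) • mlog σ))))

/-- The modified auxiliary function `Ẽ₀(s, P, σ)`. -/
noncomputable def E0Tilde {X : Type} [Fintype X] {d : ℕ}
    (W : X → Matrix (Fin d) (Fin d) ℂ) (s : ℝ) (P : X → ℝ)
    (σ : Matrix (Fin d) (Fin d) ℂ) : ℝ :=
  - Real.log (∑ x, P x * reTr (mpow (W x) (1 - s) * mpow σ s))

/-- The sphere-packing exponent `E_sp^{(2)}(R, P, σ)`. -/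
noncomputable def Esp2 {X : Type} [Fintype X] {d : ℕ}
    (W : X → Matrix (Fin d) (Fin d) ℂ) (R : ℝ) (P : X → ℝ)
    (σ : Matrix (Fin d) (Fin d) ℂ) : ℝ :=
  sSup { e : ℝ | ∃ s : ℝ, 0 ≤ s ∧ e = Eh W s P σ - s * R }

/-- The sphere-packing exponent `Ẽ_sp(R, P, σ)`. -/
noncomputable def EspTilde {X : Type} [Fintype X] {d : ℕ}
    (W : X → Matrix (Fin d) (Fin d) ℂ) (R : ℝ) (P : X → ℝ)
    (σ : Matrix (Fin d) (Fin d) ℂ) : ℝ :=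
  sSup { e : ℝ | ∃ s : ℝ, 0 ≤ s ∧ e = EhTilde W s P σ - s * R }

open Classical in
/-- Empirical distribution of a word `x^n ∈ X^n`. -/
noncomputable def empDist {X : Type} [Fintype X] {n : ℕ} (xs : Fin n → X) (x : X) : ℝ :=
  ((Finset.univ.filter fun i => xs i = x).card : ℝ) / n

/-- Smallest average error probability `ε*(n, R)` over all `n`-blocklength codes with
`⌈exp (n R)⌉` messages. -/
noncomputable def optErr {X : Type} [Fintype X] {d : ℕ}
    (W : X → Matrix (Fin d) (Fin d) ℂ) (n : ℕ) (R : ℝ) : ℝ :=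
  sInf { e : ℝ | ∃ (f : Fin ⌈Real.exp (n * R)⌉₊ → Fin n → X)
    (Pov : Fin ⌈Real.exp (n * R)⌉₊ → Matrix (Fin n → Fin d) (Fin n → Fin d) ℂ),
    (∀ m, (Pov m).PosSemidef) ∧ (∑ m, Pov m) = 1 ∧
    e = (1 / (⌈Real.exp (n * R)⌉₊ : ℝ)) *
      ∑ m, (1 - reTr (Pov m * tensorSeq (fun k => W (f m k)))) }

/-- The binary entropy function. -/
noncomputable def binEnt (p : ℝ) : ℝ :=
  -p * Real.log p - (1 - p) * Real.log (1 - p)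

theorem sigmoid_sub_le (K u : ℝ) :
    Real.sigmoid (u - K) ≤ Real.sigmoid (-K) + 1 / 4 * |u| := by
  have h1 : ∀ x ∈ (Set.univ : Set ℝ), ‖deriv Real.sigmoid x‖ ≤ 1 / 4 := by
    intro x _
    rw [Real.deriv_sigmoid, Real.norm_eq_abs, abs_of_nonneg]
    · nlinarith [sq_nonneg (Real.sigmoid x - 1 / 2)]
    · exact mul_nonneg (Real.sigmoid_nonneg x) (by linarith [Real.sigmoid_le_one x])
  have h2 := convex_univ.norm_image_sub_le_of_norm_deriv_le
    (fun x _ => differentiableAt_sigmoid) h1 (Set.mem_univ (-K)) (Set.mem_univ (u - K))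
  rw [Real.norm_eq_abs, Real.norm_eq_abs] at h2
  have h3 : u - K - -K = u := by ring
  rw [h3] at h2
  linarith [le_abs_self (Real.sigmoid (u - K) - Real.sigmoid (-K))]

theorem cubic_le_exp (t : ℝ) : 1 + t + t ^ 2 / 2 + t ^ 3 / 6 ≤ Real.exp t := by
  have key : ∀ x : ℝ, HasDerivAt (fun x => Real.exp (-x) * (1 + x + x ^ 2 / 2 + x ^ 3 / 6))
      (-(Real.exp (-x) * (x ^ 3 / 6))) x := by
    intro x
    have h1 : HasDerivAt (fun x : ℝ => Real.exp (-x)) (Real.exp (-x) * -1) x :=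
      (hasDerivAt_neg x).exp
    have h2 : HasDerivAt (fun x : ℝ => 1 + x + x ^ 2 / 2 + x ^ 3 / 6)
        (1 + 2 * x / 2 + 3 * x ^ 2 / 6) x := by
      have := (((hasDerivAt_id x).const_add 1).add ((hasDerivAt_pow 2 x).div_const 2)).add
        ((hasDerivAt_pow 3 x).div_const 6)
      exact this.congr_deriv (by norm_num)
    exact (h1.mul h2).congr_deriv (by ring)
  have h0 : Real.exp (-t) * (1 + t + t ^ 2 / 2 + t ^ 3 / 6) ≤ 1 := by
    have hd : Differentiable ℝ (fun x : ℝ => Real.exp (-x) * (1 + x + x ^ 2 / 2 + x ^ 3 / 6)) :=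
      fun x => (key x).differentiableAt
    rcases le_total 0 t with ht | ht
    · have := antitoneOn_of_deriv_nonpos (convex_Ici (0:ℝ)) hd.continuous.continuousOn
        hd.differentiableOn (fun x hx => by
          rw [interior_Ici] at hx
          rw [(key x).deriv, neg_nonpos]
          have : 0 < x := hx
          positivity)
      simpa using this Set.self_mem_Ici ht ht
    · have := monotoneOn_of_deriv_nonneg (convex_Iic (0:ℝ)) hd.continuous.continuousOn
        hd.differentiableOn (fun x hx => by
          rw [interior_Iic] at hx
          rw [(key x).deriv, neg_nonneg]
          have h : x < 0 := hx
          have : x ^ 3 ≤ 0 := (Odd.pow_neg (by decide) h).le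
          exact mul_nonpos_of_nonneg_of_nonpos (Real.exp_pos _).le (by linarith))
      simpa using this ht Set.self_mem_Iic ht
  rw [Real.exp_neg, inv_mul_le_iff₀ (Real.exp_pos t)] at h0
  linarith

theorem small_gap_bound {K : ℝ} (hK : 0 < K) (hK2 : K ≤ 12 / 5) :
    K ^ 2 * (1 / 4) ^ 2 +
      (Real.sigmoid (-K) * Real.exp (K / 2) + 1 / 2 * Real.exp ((K - K) / 2)) ^ 2 ≤ 1 := by
  set y := K ^ 2 / 4 with hy
  have hc : 1 + (K / 2) ^ 2 / 2 ≤ Real.cosh (K / 2) := by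
    rw [Real.cosh_eq]
    linarith [cubic_le_exp (K / 2), cubic_le_exp (-(K / 2))]
  have he : Real.sigmoid (-K) * Real.exp (K / 2) = 1 / (2 * Real.cosh (K / 2)) := by
    rw [Real.sigmoid_def, Real.cosh_eq, neg_neg]
    have : Real.exp K = Real.exp (K / 2) * Real.exp (K / 2) := by
      rw [← Real.exp_add]; ring_nf
    rw [Real.exp_neg, this]
    have := Real.exp_pos (K / 2)
    field_simp
    ring
  have hle : Real.sigmoid (-K) * Real.exp (K / 2) ≤ 1 / (2 + y) := by
    rw [he]
    apply one_div_le_one_div_of_le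
    · positivity
    · nlinarith
  have h0 : 0 ≤ Real.sigmoid (-K) * Real.exp (K / 2) :=
    mul_nonneg (Real.sigmoid_nonneg _) (Real.exp_pos _).le
  have hy0 : 0 < y := by positivity
  have hy1 : y ≤ 36 / 25 := by nlinarith
  have hsq : (Real.sigmoid (-K) * Real.exp (K / 2) + 1 / 2 * Real.exp ((K - K) / 2)) ^ 2
      ≤ (1 / (2 + y) + 1 / 2) ^ 2 := by
    have : Real.exp ((K - K) / 2) = 1 := by simp
    rw [this]
    apply pow_le_pow_left₀ (by positivity)
    linarith
  have hfin : (1 / (2 + y) + 1 / 2) ^ 2 ≤ 1 - y / 4 := by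
    have : 1 / (2 + y) + 1 / 2 = (4 + y) / (2 * (2 + y)) := by field_simp; ring
    rw [this, div_pow, div_le_iff₀ (by positivity)]
    nlinarith [mul_pos hy0 hy0, mul_nonneg hy0.le (show (0:ℝ) ≤ 4 - y - y ^ 2 by nlinarith)]
  have : K ^ 2 * (1 / 4) ^ 2 = y / 4 := by rw [hy]; ring
  linarith

/-- A line through the origin tangent to a shifted logistic function dominates it, up to the value
of its exponential tail at the origin. -/
theorem sigmoid_le_tangent {K u : ℝ} (hK : 12 / 5 ≤ K) :
    Real.sigmoid (u - (1 + K - Real.log K)) ≤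
      K * Real.exp (-(1 + K)) + K / (1 + K) ^ 2 * |u| := by
  have hK0 : 0 < K := by linarith
  have hexp : Real.exp (-(1 + K - Real.log K)) = K * Real.exp (-(1 + K)) := by
    rw [neg_sub, sub_eq_add_neg, Real.exp_add, Real.exp_log hK0]
  have hsl : 0 ≤ K / (1 + K) ^ 2 := by positivity
  have htail : ∀ w, Real.sigmoid (w - (1 + K - Real.log K)) ≤ K * Real.exp (-(1 + K)) * Real.exp w := by
    intro w
    rw [← hexp, ← Real.exp_add, Real.sigmoid_def,
      show -(1 + K - Real.log K) + w = w - (1 + K - Real.log K) by ring]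
    rw [inv_le_comm₀ (by positivity) (Real.exp_pos _), ← Real.exp_neg]
    linarith
  rcases le_or_gt u 0 with hu | hu
  · have := htail u
    have h1 : Real.exp u ≤ 1 := Real.exp_le_one_iff.2 hu
    have h2 : 0 < K * Real.exp (-(1 + K)) := by positivity
    nlinarith [mul_nonneg hsl (abs_nonneg u)]
  rw [abs_of_pos hu]
  rcases le_or_gt u (3 / 2) with hu2 | hu2
  · have hconv : Real.exp u ≤ 1 + u * (7 / 3) := by
      have h32 : Real.exp (3 / 2) ≤ 9 / 2 := by
        have h1 := Real.exp_one_lt_d9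
        have : Real.exp (3 / 2) ^ 2 = Real.exp 1 ^ 3 := by
          rw [← Real.exp_nat_mul, ← Real.exp_nat_mul]; norm_num
        have h3 : Real.exp 1 ^ 3 ≤ (2.7182818286 : ℝ) ^ 3 :=
          pow_le_pow_left₀ (Real.exp_pos _).le h1.le 3
        exact le_of_sq_le_sq (by rw [this]; norm_num at h3 ⊢; linarith) (by norm_num)
      have := convexOn_exp.2 (Set.mem_univ 0) (Set.mem_univ (3 / 2 : ℝ))
        (show 0 ≤ 1 - u / (3 / 2) by linarith [div_le_one_of_le₀ hu2 (by norm_num)])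
        (show 0 ≤ u / (3 / 2) by positivity) (by ring)
      simp only [smul_eq_mul, mul_zero, zero_add, Real.exp_zero, mul_one] at this
      rw [div_mul_cancel₀ _ (by norm_num)] at this
      nlinarith
    have hN : 7 / 3 * (1 + K) ^ 2 ≤ Real.exp (1 + K) := by
      have h := Real.sum_le_exp_of_nonneg (show 0 ≤ 1 + K by linarith) 7
      simp only [Finset.sum_range_succ, Finset.sum_range_zero, Nat.factorial] at h
      norm_num at h
      refine le_trans ?_ h
      obtain ⟨t, rfl⟩ : ∃ t, K = 12 / 5 + t := ⟨K - 12 / 5, by ring⟩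
      have ht : 0 ≤ t := by linarith
      rw [← sub_nonneg]
      ring_nf
      positivity
    have h1 := htail u
    have h2 : K * Real.exp (-(1 + K)) * (7 / 3) ≤ K / (1 + K) ^ 2 := by
      rw [le_div_iff₀ (by positivity), Real.exp_neg]
      have : K * (Real.exp (1 + K))⁻¹ * (7 / 3) * (1 + K) ^ 2
        = K * ((7 / 3 * (1 + K) ^ 2) / Real.exp (1 + K)) := by field_simp
      rw [this]
      have := (div_le_one (Real.exp_pos (1 + K))).2 hN
      nlinarith
    have h3 : 0 < K * Real.exp (-(1 + K)) := by positivity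
    calc _ ≤ _ := h1
      _ ≤ K * Real.exp (-(1 + K)) * (1 + u * (7 / 3)) := by gcongr
      _ ≤ _ := by nlinarith
  · suffices h : Real.sigmoid (u - (1 + K - Real.log K)) ≤ K / (1 + K) ^ 2 * u by
      have : 0 < K * Real.exp (-(1 + K)) := by positivity
      linarith
    have he : Real.exp (-(u - (1 + K - Real.log K))) = Real.exp (1 + K - u) / K := by
      rw [show -(u - (1 + K - Real.log K)) = (1 + K - u) - Real.log K by ring, Real.exp_sub,
        Real.exp_log hK0]
    rw [Real.sigmoid_def, he, inv_le_comm₀ (by positivity) (by positivity)]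
    rw [inv_eq_one_div, div_le_iff₀ (by positivity)]
    have hmain : (1 + K) ^ 2 ≤ u * (K + Real.exp (1 + K - u)) := by
      obtain ⟨t, ht⟩ : ∃ t, t = 1 + K - u := ⟨_, rfl⟩
      rw [← ht]
      have hut : u = 1 + K - t := by linarith
      rcases le_or_gt t (-3 / 2) with ht2 | ht2
      · have := Real.exp_pos t
        nlinarith
      · have h6 : 6 ≤ u * (3 + t) := by
          have : t ≤ K - 1 / 2 := by linarith
          rw [hut]
          nlinarith [mul_nonneg (show 0 ≤ t + 3 / 2 by linarith) (show 0 ≤ K - 1 / 2 - t by linarith)]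
        have h7 : u * (K + (1 + t + t ^ 2 / 2 + t ^ 3 / 6)) ≤ u * (K + Real.exp t) := by
          have := cubic_le_exp t
          gcongr
        have h8 : u * (K + (1 + t + t ^ 2 / 2 + t ^ 3 / 6)) - (1 + K) ^ 2
            = t ^ 2 / 6 * (u * (3 + t) - 6) := by rw [hut]; ring
        nlinarith [mul_nonneg (show 0 ≤ t ^ 2 / 6 by positivity) (sub_nonneg.2 h6)]
    have : (1 + Real.exp (1 + K - u) / K) * (K / (1 + K) ^ 2 * u)
        = u * (K + Real.exp (1 + K - u)) / (1 + K) ^ 2 := by field_simp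
    rw [this, le_div_iff₀ (by positivity)]
    linarith

theorem large_gap_bound {K : ℝ} (hK : 12 / 5 ≤ K) :
    K ^ 2 * (K / (1 + K) ^ 2) ^ 2 +
      (K * Real.exp (-(1 + K)) * Real.exp (K / 2) +
        1 / 2 * Real.exp ((1 + K - Real.log K - K) / 2)) ^ 2 ≤ 1 := by
  have hK0 : 0 < K := by linarith
  set a := K * Real.exp (-(1 + K)) * Real.exp (K / 2) with ha
  set b := 1 / 2 * Real.exp ((1 + K - Real.log K - K) / 2) with hb
  have e1 := Real.exp_one_gt_d9
  have e2 := Real.exp_one_lt_d9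
  have hb2 : b ^ 2 ≤ 7 / 10 / K := by
    have : b ^ 2 = Real.exp 1 / 4 / K := by
      rw [hb, mul_pow, ← Real.exp_nat_mul,
        show ((2 : ℕ) : ℝ) * ((1 + K - Real.log K - K) / 2) = 1 - Real.log K by push_cast; ring,
        Real.exp_sub, Real.exp_log hK0]
      ring
    rw [this]
    rw [div_le_div_iff_of_pos_right hK0]
    linarith
  have ha2 : a ^ 2 ≤ 1 / 5 / K := by
    have h1 : a ^ 2 = K ^ 2 * Real.exp (-(K + 2)) := by
      rw [ha, mul_pow, mul_pow, ← Real.exp_nat_mul, ← Real.exp_nat_mul, mul_assoc, ← Real.exp_add]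
      congr 2; push_cast; ring
    have h2 : (K / 3) ^ 3 ≤ Real.exp (K - 3) := by
      have : Real.exp (K - 3) = Real.exp (K / 3 - 1) ^ 3 := by
        rw [← Real.exp_nat_mul]; congr 1; push_cast; ring
      rw [this]
      apply pow_le_pow_left₀ (by positivity)
      linarith [Real.add_one_le_exp (K / 3 - 1)]
    have h5 : (135 : ℝ) ≤ Real.exp 5 := by
      have : Real.exp 5 = Real.exp 1 ^ 5 := by rw [← Real.exp_nat_mul]; norm_num
      rw [this]
      calc (135 : ℝ) ≤ 2.7182818283 ^ 5 := by norm_num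
        _ ≤ _ := pow_le_pow_left₀ (by norm_num) e1.le 5
    have h3 : 5 * K ^ 3 ≤ Real.exp (K + 2) := by
      have : Real.exp (K + 2) = Real.exp (K - 3) * Real.exp 5 := by
        rw [← Real.exp_add]; congr 1; ring
      rw [this]
      calc 5 * K ^ 3 = (K / 3) ^ 3 * 135 := by ring
        _ ≤ _ := by gcongr
    rw [h1, Real.exp_neg, le_div_iff₀ hK0]
    rw [show K ^ 2 * (Real.exp (K + 2))⁻¹ * K = K ^ 3 / Real.exp (K + 2) by field_simp]
    rw [div_le_iff₀ (Real.exp_pos _)]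
    linarith
  have hab : (a + b) ^ 2 ≤ 33 / 20 / K := by
    have : (a + b) ^ 2 ≤ 3 * a ^ 2 + 3 / 2 * b ^ 2 := by nlinarith [sq_nonneg (2 * a - b)]
    have h : 3 * (1 / 5 / K) + 3 / 2 * (7 / 10 / K) = 33 / 20 / K := by ring
    linarith
  have hpoly : K ^ 2 * (K / (1 + K) ^ 2) ^ 2 ≤ 1 - 33 / 20 / K := by
    rw [show K ^ 2 * (K / (1 + K) ^ 2) ^ 2 = K ^ 4 / (1 + K) ^ 4 by field_simp,
      div_le_iff₀ (by positivity)]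
    rw [show (1 - 33 / 20 / K) * (1 + K) ^ 4 = (K - 33 / 20) * (1 + K) ^ 4 / K by field_simp,
      le_div_iff₀ hK0]
    nlinarith [mul_nonneg (sub_nonneg.2 hK) (pow_pos hK0 3).le, mul_nonneg (sub_nonneg.2 hK) (pow_pos hK0 2).le, mul_nonneg (sub_nonneg.2 hK) hK0.le]
  linarith

theorem exists_logistic_majorant {K : ℝ} (hK : 0 < K) :
    ∃ s ε c : ℝ, 0 ≤ ε ∧ 0 ≤ c ∧ (∀ u, Real.sigmoid (u - s) ≤ ε + c * |u|) ∧
      ∀ x, 0 ≤ x → (ε + c * x + 1 / 2 * Real.exp (s / 2 - K)) ^ 2 ≤ x ^ 2 / K ^ 2 + Real.exp (-K) := by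
  obtain ⟨s, ε, c, hε, hc, h1, h2⟩ : ∃ s ε c : ℝ, 0 ≤ ε ∧ 0 ≤ c ∧
      (∀ u, Real.sigmoid (u - s) ≤ ε + c * |u|) ∧
      K ^ 2 * c ^ 2 + (ε * Real.exp (K / 2) + 1 / 2 * Real.exp ((s - K) / 2)) ^ 2 ≤ 1 := by
    rcases le_total K (12 / 5) with h | h
    · exact ⟨K, Real.sigmoid (-K), 1 / 4, Real.sigmoid_nonneg _, by norm_num, sigmoid_sub_le K,
        small_gap_bound hK h⟩
    · exact ⟨1 + K - Real.log K, K * Real.exp (-(1 + K)), K / (1 + K) ^ 2, by positivity,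
        by positivity, fun _ => sigmoid_le_tangent h, large_gap_bound h⟩
  refine ⟨s, ε, c, hε, hc, h1, fun x hx => ?_⟩
  set δ := ε * Real.exp (K / 2) + 1 / 2 * Real.exp ((s - K) / 2) with hδ
  set r := Real.exp (-(K / 2)) with hr
  have e1 : ε + 1 / 2 * Real.exp (s / 2 - K) = δ * r := by
    rw [hδ, hr, add_mul, mul_assoc, mul_assoc, ← Real.exp_add, ← Real.exp_add]
    rw [show K / 2 + -(K / 2) = 0 by ring, show (s - K) / 2 + -(K / 2) = s / 2 - K by ring]
    simp
  have e2 : Real.exp (-K) = r ^ 2 := by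
    rw [hr, ← Real.exp_nat_mul]; congr 1; push_cast; ring
  have e3 : ε + c * x + 1 / 2 * Real.exp (s / 2 - K) = (K * c) * (x / K) + δ * r := by
    rw [← e1]; field_simp; ring
  rw [e3, e2, ← div_pow]
  nlinarith [sq_nonneg (K * c * r - δ * (x / K)), sq_nonneg (x / K), sq_nonneg r,
    mul_le_mul_of_nonneg_right h2 (add_nonneg (sq_nonneg (x / K)) (sq_nonneg r))]

/-- Weighting a contraction entrywise by `√(l i * m j) / (l i + m j)` halves its norm
(bilinear form version). -/
theorem re_sum_geom_div_arith_le {ι κ : Type*} [Fintype ι] [Fintype κ] {N : ι → κ → ℂ}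
    (hN : ∀ (b : ι → ℂ) (a : κ → ℂ), (∑ i, ∑ j, star (b i) * N i j * a j).re ≤
      1 / 2 * (∑ i, ‖b i‖ ^ 2 + ∑ j, ‖a j‖ ^ 2))
    {l : ι → ℝ} {m : κ → ℝ} (hl : ∀ i, 0 ≤ l i) (hm : ∀ j, 0 < m j) (b : ι → ℂ) (a : κ → ℂ) :
    (∑ i, ∑ j, star (b i) * ((√(l i) * √(m j) / (l i + m j) : ℝ) * N i j) * a j).re ≤
      1 / 4 * (∑ i, ‖b i‖ ^ 2 + ∑ j, ‖a j‖ ^ 2) := by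
  set r : ι → κ → ℝ := fun i j => (star (b i) * N i j * a j).re with hr
  set g : ι → κ → ℝ := fun i j => √(l i) * √(m j) / (l i + m j) * r i j with hg
  have hlm : ∀ i j, 0 < l i + m j := fun i j => add_pos_of_nonneg_of_pos (hl i) (hm j)
  have hL : (∑ i, ∑ j, star (b i) * ((√(l i) * √(m j) / (l i + m j) : ℝ) * N i j) * a j).re
      = ∑ i, ∑ j, g i j := by
    simp only [Complex.re_sum]
    refine Finset.sum_congr rfl fun i _ => Finset.sum_congr rfl fun j _ => ?_
    rw [hg, hr]
    rw [show star (b i) * ((√(l i) * √(m j) / (l i + m j) : ℝ) * N i j) * a j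
      = ((√(l i) * √(m j) / (l i + m j) : ℝ) : ℂ) * (star (b i) * N i j * a j) by ring]
    rw [Complex.re_ofReal_mul]
  rw [hL]
  set H : ℝ → ℝ := fun t => 1 / 4 * (∑ i, ‖b i‖ ^ 2 * Real.exp (-(2 * l i) * t)
    + ∑ j, ‖a j‖ ^ 2 * Real.exp (-(2 * m j) * t))
    - ∑ i, ∑ j, g i j * Real.exp (-(l i + m j) * t) with hH
  have hexp : ∀ c t : ℝ, HasDerivAt (fun t => Real.exp (-c * t)) (-c * Real.exp (-c * t)) t := by
    intro c t
    have := ((hasDerivAt_id t).const_mul (-c)).exp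
    exact this.congr_deriv (by simp [mul_comm])
  have hderiv : ∀ t, HasDerivAt H (1 / 4 * (∑ i, ‖b i‖ ^ 2 * (-(2 * l i) * Real.exp (-(2 * l i) * t))
      + ∑ j, ‖a j‖ ^ 2 * (-(2 * m j) * Real.exp (-(2 * m j) * t)))
      - ∑ i, ∑ j, g i j * (-(l i + m j) * Real.exp (-(l i + m j) * t))) t := by
    intro t
    exact (((HasDerivAt.fun_sum fun i _ => (hexp _ t).const_mul _).add
      (HasDerivAt.fun_sum fun j _ => (hexp _ t).const_mul _)).const_mul _).sub
      (HasDerivAt.fun_sum fun i _ => HasDerivAt.fun_sum fun j _ => (hexp _ t).const_mul _)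
  have hsq : ∀ (x t : ℝ) (z : ℂ), 0 ≤ x →
      ‖((√x * Real.exp (-x * t) : ℝ) : ℂ) * z‖ ^ 2 = x * Real.exp (-(2 * x) * t) * ‖z‖ ^ 2 := by
    intro x t z hx
    rw [norm_mul, mul_pow, Complex.norm_real, Real.norm_eq_abs, sq_abs, mul_pow, Real.sq_sqrt hx,
      ← Real.exp_nat_mul]
    congr 3; push_cast; ring
  have hanti : Antitone H := by
    apply antitone_of_deriv_nonpos (fun t => (hderiv t).differentiableAt)
    intro t
    rw [(hderiv t).deriv]
    have h := hN (fun i => ((√(l i) * Real.exp (-l i * t) : ℝ) : ℂ) * b i)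
      (fun j => ((√(m j) * Real.exp (-m j * t) : ℝ) : ℂ) * a j)
    have e1 : (∑ i, ∑ j, star (((√(l i) * Real.exp (-l i * t) : ℝ) : ℂ) * b i) * N i j *
        (((√(m j) * Real.exp (-m j * t) : ℝ) : ℂ) * a j)).re
        = ∑ i, ∑ j, g i j * ((l i + m j) * Real.exp (-(l i + m j) * t)) := by
      simp only [Complex.re_sum]
      refine Finset.sum_congr rfl fun i _ => Finset.sum_congr rfl fun j _ => ?_
      rw [star_mul']
      rw [show star ((√(l i) * Real.exp (-l i * t) : ℝ) : ℂ)
        = ((√(l i) * Real.exp (-l i * t) : ℝ) : ℂ) from Complex.conj_ofReal _]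
      rw [show ((√(l i) * Real.exp (-l i * t) : ℝ) : ℂ) * star (b i) * N i j *
        (((√(m j) * Real.exp (-m j * t) : ℝ) : ℂ) * a j) =
        (((√(l i) * Real.exp (-l i * t)) * (√(m j) * Real.exp (-m j * t)) : ℝ) : ℂ)
          * (star (b i) * N i j * a j) by push_cast; ring]
      rw [Complex.re_ofReal_mul, hg]
      have : Real.exp (-(l i + m j) * t) = Real.exp (-l i * t) * Real.exp (-m j * t) := by
        rw [← Real.exp_add]; ring_nf
      have h3 := hlm i j
      simp only [this]
      field_simp
      rfl
    rw [e1] at h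
    simp only [hsq _ t _ (hl _), hsq _ t _ (hm _).le] at h
    have e2 : ∑ i, ‖b i‖ ^ 2 * (-(2 * l i) * Real.exp (-(2 * l i) * t))
        = -2 * ∑ i, l i * Real.exp (-(2 * l i) * t) * ‖b i‖ ^ 2 := by
      rw [Finset.mul_sum]; exact Finset.sum_congr rfl fun i _ => by ring
    have e3 : ∑ i, ‖a i‖ ^ 2 * (-(2 * m i) * Real.exp (-(2 * m i) * t))
        = -2 * ∑ i, m i * Real.exp (-(2 * m i) * t) * ‖a i‖ ^ 2 := by
      rw [Finset.mul_sum]; exact Finset.sum_congr rfl fun i _ => by ring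
    have e4 : ∑ i, ∑ j, g i j * (-(l i + m j) * Real.exp (-(l i + m j) * t))
        = - ∑ i, ∑ j, g i j * ((l i + m j) * Real.exp (-(l i + m j) * t)) := by
      simp only [← Finset.sum_neg_distrib]
      exact Finset.sum_congr rfl fun i _ => Finset.sum_congr rfl fun j _ => by ring
    rw [e2, e3, e4]
    linarith
  have htend : Tendsto (fun t => - ∑ i, ∑ j, g i j * Real.exp (-(l i + m j) * t)) atTop (nhds 0) := by
    have : Tendsto (fun t => - ∑ i, ∑ j, g i j * Real.exp (-(l i + m j) * t)) atTop
        (nhds (-∑ i, ∑ j, g i j * 0)) := by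
      refine (tendsto_finsetSum _ fun i _ => tendsto_finsetSum _ fun j _ =>
        Tendsto.const_mul _ ?_).neg
      exact Real.tendsto_exp_atBot.comp
        (tendsto_id.const_mul_atTop_of_neg (neg_lt_zero.2 (hlm i j)))
    simpa using this
  have h0 : 0 ≤ H 0 := by
    refine le_of_tendsto htend ?_
    filter_upwards [eventually_ge_atTop 0] with t ht
    refine le_trans ?_ (hanti ht)
    rw [hH]
    have : 0 ≤ ∑ i, ‖b i‖ ^ 2 * Real.exp (-(2 * l i) * t)
      + ∑ j, ‖a j‖ ^ 2 * Real.exp (-(2 * m j) * t) := by positivity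
    simp only
    linarith
  simp only [hH, mul_zero, Real.exp_zero, mul_one] at h0
  linarith

/-- Weighting a contraction entrywise by `√(l i * m j) / (l i + m j)` halves its norm. -/
theorem sum_norm_sq_geom_div_arith_le {ι κ : Type*} [Fintype ι] [Fintype κ] {N : ι → κ → ℂ}
    (hN : ∀ (b : ι → ℂ) (a : κ → ℂ), (∑ i, ∑ j, star (b i) * N i j * a j).re ≤
      1 / 2 * (∑ i, ‖b i‖ ^ 2 + ∑ j, ‖a j‖ ^ 2))
    {l : ι → ℝ} {m : κ → ℝ} (hl : ∀ i, 0 ≤ l i) (hm : ∀ j, 0 < m j) (a : κ → ℂ) :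
    ∑ i, ‖∑ j, ((√(l i) * √(m j) / (l i + m j) : ℝ) * N i j) * a j‖ ^ 2 ≤
      1 / 4 * ∑ j, ‖a j‖ ^ 2 := by
  set y : ι → ℂ := fun i => ∑ j, ((√(l i) * √(m j) / (l i + m j) : ℝ) * N i j) * a j with hy
  have h := re_sum_geom_div_arith_le hN hl hm (fun i => 2 * y i) a
  have e : (∑ i, ∑ j, star (2 * y i) * ((√(l i) * √(m j) / (l i + m j) : ℝ) * N i j) * a j).re
      = 2 * ∑ i, ‖y i‖ ^ 2 := by
    rw [Complex.re_sum, Finset.mul_sum]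
    refine Finset.sum_congr rfl fun i _ => ?_
    simp only [mul_assoc, ← Finset.mul_sum]
    simp only [← mul_assoc]
    change (star (2 * y i) * y i).re = _
    rw [star_mul', mul_assoc, show star (y i) * y i = ((‖y i‖ ^ 2 : ℝ) : ℂ) by
      rw [Complex.star_def, Complex.conj_mul']; push_cast; rfl]
    simp [-Complex.ofReal_pow]
  rw [e] at h
  simp only [norm_mul, mul_pow, Complex.norm_ofNat, ← Finset.mul_sum] at h
  linarith

theorem sqrt_sum_norm_add_sq_le {ι : Type*} [Fintype ι] (x y : ι → ℂ) :
    √(∑ i, ‖x i + y i‖ ^ 2) ≤ √(∑ i, ‖x i‖ ^ 2) + √(∑ i, ‖y i‖ ^ 2) := by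
  have := norm_add_le (WithLp.toLp 2 x) (WithLp.toLp 2 y)
  simpa only [EuclideanSpace.norm_eq, PiLp.add_apply] using this

theorem sqrt_success_le {ι κ τ : Type*} [Fintype ι] [Fintype κ] [Fintype τ] {N : ι → κ → ℂ}
    (hN : ∀ (b : ι → ℂ) (a : κ → ℂ), (∑ i, ∑ j, star (b i) * N i j * a j).re ≤
      1 / 2 * (∑ i, ‖b i‖ ^ 2 + ∑ j, ‖a j‖ ^ 2))
    {C : τ → κ → ℂ} (hC : ∀ v : κ → ℂ, ∑ k, ‖∑ j, C k j * v j‖ ^ 2 ≤ ∑ j, ‖v j‖ ^ 2)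
    {l : ι → ℝ} {m : κ → ℝ} (hl : ∀ i, 0 ≤ l i) (hm : ∀ j, 0 < m j) :
    √(∑ i, l i * ∑ k, ‖∑ j, C k j * N i j‖ ^ 2) ≤
      √(∑ i, ∑ j, l i * ‖N i j‖ ^ 2 * (l i / (l i + m j)) ^ 2) +
      1 / 2 * √(∑ j, m j * ∑ k, ‖C k j‖ ^ 2) := by
  have hlm : ∀ i j, 0 < l i + m j := fun i j => add_pos_of_nonneg_of_pos (hl i) (hm j)
  set x : ι × τ → ℂ := fun p => √(l p.1) * ∑ j, C p.2 j * (((l p.1 / (l p.1 + m j) : ℝ) : ℂ) * N p.1 j) with hx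
  set y : ι × τ → ℂ := fun p => ∑ j, ((√(l p.1) * √(m j) / (l p.1 + m j) : ℝ) * N p.1 j) *
    (√(m j) * C p.2 j) with hy
  have h := sqrt_sum_norm_add_sq_le x y
  have e : ∑ i, l i * ∑ k, ‖∑ j, C k j * N i j‖ ^ 2 = ∑ p, ‖x p + y p‖ ^ 2 := by
    rw [Fintype.sum_prod_type]
    refine Finset.sum_congr rfl fun i _ => ?_
    rw [Finset.mul_sum]
    refine Finset.sum_congr rfl fun k _ => ?_
    have : x (i, k) + y (i, k) = √(l i) * ∑ j, C k j * N i j := by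
      simp only [hx, hy, Finset.mul_sum, ← Finset.sum_add_distrib]
      refine Finset.sum_congr rfl fun j _ => ?_
      have h1 : ((l i + m j : ℝ) : ℂ) ≠ 0 := by exact_mod_cast (hlm i j).ne'
      have h2 : ((√(m j) : ℝ) : ℂ) * √(m j) = m j := by
        rw [← Complex.ofReal_mul, Real.mul_self_sqrt (hm j).le]
      push_cast at h1 ⊢
      field_simp
      linear_combination (√(l i) * C k j * N i j) * h2
    rw [this, norm_mul, mul_pow, Complex.norm_real, Real.norm_eq_abs, sq_abs, Real.sq_sqrt (hl i)]
  rw [e]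
  refine h.trans (add_le_add (Real.sqrt_le_sqrt ?_) ?_)
  · rw [Fintype.sum_prod_type]
    refine Finset.sum_le_sum fun i _ => ?_
    simp only [hx, norm_mul, mul_pow, Complex.norm_real, Real.norm_eq_abs, sq_abs,
      Real.sq_sqrt (hl i), ← Finset.mul_sum]
    have := hC fun j => ((l i / (l i + m j) : ℝ) : ℂ) * N i j
    simp only [norm_mul, mul_pow, Complex.norm_real, Real.norm_eq_abs, sq_abs] at this
    refine (mul_le_mul_of_nonneg_left this (hl i)).trans (le_of_eq ?_)
    rw [Finset.mul_sum]
    exact Finset.sum_congr rfl fun j _ => by ring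
  · rw [show (1 / 2 : ℝ) = √(1 / 4) by
      rw [show (1 / 4 : ℝ) = (1 / 2) ^ 2 by norm_num, Real.sqrt_sq (by norm_num)],
      ← Real.sqrt_mul (by norm_num)]
    apply Real.sqrt_le_sqrt
    rw [Fintype.sum_prod_type_right]
    have : ∀ k, ∑ i, ‖y (i, k)‖ ^ 2 ≤ 1 / 4 * ∑ j, m j * ‖C k j‖ ^ 2 := by
      intro k
      have := sum_norm_sq_geom_div_arith_le hN hl hm fun j => √(m j) * C k j
      simpa only [norm_mul, mul_pow, Complex.norm_real, Real.norm_eq_abs, sq_abs,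
        Real.sq_sqrt (hm _).le] using this
    refine (Finset.sum_le_sum fun k _ => this k).trans (le_of_eq ?_)
    simp only [← Finset.mul_sum]
    rw [Finset.sum_comm]
    simp only [Finset.mul_sum]


theorem success_le {ι κ τ : Type*} [Fintype ι] [Fintype κ] [Fintype τ] {N : ι → κ → ℂ}
    (hN : ∀ (b : ι → ℂ) (a : κ → ℂ), (∑ i, ∑ j, star (b i) * N i j * a j).re ≤
      1 / 2 * (∑ i, ‖b i‖ ^ 2 + ∑ j, ‖a j‖ ^ 2))
    {C : τ → κ → ℂ} (hC : ∀ v : κ → ℂ, ∑ k, ‖∑ j, C k j * v j‖ ^ 2 ≤ ∑ j, ‖v j‖ ^ 2)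
    {l : ι → ℝ} {m : κ → ℝ} (hl : ∀ i, 0 ≤ l i) (hm : ∀ j, 0 < m j)
    (hw : ∑ i, ∑ j, l i * ‖N i j‖ ^ 2 = 1) {D K V : ℝ} (hK : 0 < K) {u : ι → κ → ℝ}
    (hu : ∀ i j, 0 < l i → l i = Real.exp (D + u i j) * m j)
    (hV : ∑ i, ∑ j, l i * ‖N i j‖ ^ 2 * u i j ^ 2 ≤ V)
    (hq : ∑ j, m j * ∑ k, ‖C k j‖ ^ 2 ≤ Real.exp (-(D + 2 * K))) :
    ∑ i, l i * ∑ k, ‖∑ j, C k j * N i j‖ ^ 2 ≤ V / K ^ 2 + Real.exp (-K) := by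
  obtain ⟨s, ε, c, hε, hc, h1, h2⟩ := exists_logistic_majorant hK
  have hV0 : 0 ≤ V := le_trans (Finset.sum_nonneg fun i _ => Finset.sum_nonneg fun j _ =>
    mul_nonneg (mul_nonneg (hl i) (sq_nonneg _)) (sq_nonneg _)) hV
  have hp0 : 0 ≤ ∑ i, l i * ∑ k, ‖∑ j, C k j * N i j‖ ^ 2 :=
    Finset.sum_nonneg fun i _ => mul_nonneg (hl i) (by positivity)
  have hn : ∀ j, 0 < Real.exp (D + s) * m j := fun j => mul_pos (Real.exp_pos _) (hm j)
  have h := sqrt_success_le hN hC hl hn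
  have hq2 : 1 / 2 * √(∑ j, Real.exp (D + s) * m j * ∑ k, ‖C k j‖ ^ 2) ≤
      1 / 2 * Real.exp (s / 2 - K) := by
    refine mul_le_mul_of_nonneg_left ?_ (by norm_num)
    rw [← Real.sqrt_sq (Real.exp_pos (s / 2 - K)).le]
    apply Real.sqrt_le_sqrt
    simp only [mul_assoc, ← Finset.mul_sum]
    refine (mul_le_mul_of_nonneg_left hq (Real.exp_pos _).le).trans (le_of_eq ?_)
    rw [← Real.exp_add, ← Real.exp_nat_mul]
    congr 1; push_cast; ring
  have hL : ∀ i j, l i * ‖N i j‖ ^ 2 * (l i / (l i + Real.exp (D + s) * m j)) ^ 2 ≤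
      l i * ‖N i j‖ ^ 2 * (ε + c * |u i j|) ^ 2 := by
    intro i j
    rcases (hl i).eq_or_lt with h0 | h0
    · simp [← h0]
    refine mul_le_mul_of_nonneg_left ?_ (mul_nonneg (hl i) (sq_nonneg _))
    have : l i / (l i + Real.exp (D + s) * m j) = Real.sigmoid (u i j - s) := by
      have hmj := hm j
      have hes : Real.exp (D + s) = Real.exp (D + u i j) * Real.exp (-(u i j - s)) := by
        rw [← Real.exp_add]; ring_nf
      rw [Real.sigmoid_def, hu i j h0, hes]
      have := Real.exp_pos (-(u i j - s))
      have := Real.exp_pos (D + u i j)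
      field_simp
    rw [this]
    exact pow_le_pow_left₀ (Real.sigmoid_nonneg _) (h1 _) 2
  have habs : ∑ i, ∑ j, l i * ‖N i j‖ ^ 2 * |u i j| ≤ √V := by
    apply Real.le_sqrt_of_sq_le
    have hcs := Finset.sum_mul_sq_le_sq_mul_sq (Finset.univ : Finset (ι × κ))
      (fun p => √(l p.1) * ‖N p.1 p.2‖) (fun p => √(l p.1) * ‖N p.1 p.2‖ * |u p.1 p.2|)
    simp only [Fintype.sum_prod_type, mul_pow, Real.sq_sqrt (hl _), sq_abs, hw, one_mul] at hcs
    refine le_trans (le_of_eq ?_) (hcs.trans hV)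
    congr 1
    refine Finset.sum_congr rfl fun i _ => Finset.sum_congr rfl fun j _ => ?_
    have := Real.mul_self_sqrt (hl i)
    linear_combination (- ‖N i j‖ ^ 2 * |u i j|) * this
  have hE : ∑ i, ∑ j, l i * ‖N i j‖ ^ 2 * (l i / (l i + Real.exp (D + s) * m j)) ^ 2 ≤
      (ε + c * √V) ^ 2 := by
    refine (Finset.sum_le_sum fun i _ => Finset.sum_le_sum fun j _ => hL i j).trans ?_
    have : ∑ i, ∑ j, l i * ‖N i j‖ ^ 2 * (ε + c * |u i j|) ^ 2 =
        ε ^ 2 * (∑ i, ∑ j, l i * ‖N i j‖ ^ 2) + 2 * ε * c * (∑ i, ∑ j, l i * ‖N i j‖ ^ 2 * |u i j|)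
        + c ^ 2 * (∑ i, ∑ j, l i * ‖N i j‖ ^ 2 * u i j ^ 2) := by
      simp only [Finset.mul_sum, ← Finset.sum_add_distrib]
      refine Finset.sum_congr rfl fun i _ => Finset.sum_congr rfl fun j _ => ?_
      rw [← sq_abs (u i j)]; ring
    rw [this, hw]
    have e1 := mul_le_mul_of_nonneg_left habs (show 0 ≤ 2 * ε * c by positivity)
    have e2 := mul_le_mul_of_nonneg_left hV (sq_nonneg c)
    nlinarith [Real.sq_sqrt hV0]
  have hE' := Real.sqrt_le_sqrt hE
  rw [Real.sqrt_sq (by positivity)] at hE'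
  have h3 := h2 (√V) (Real.sqrt_nonneg _)
  rw [Real.sq_sqrt hV0] at h3
  refine le_trans ?_ h3
  rw [← Real.sqrt_le_left (by positivity)]
  linarith

theorem sum_norm_sq_mulVec_le {ι : Type*} [Fintype ι] [DecidableEq ι] {A : Matrix ι ι ℂ}
    (hA : (1 - A.conjTranspose * A).PosSemidef) (v : ι → ℂ) :
    ∑ k, ‖∑ j, A k j * v j‖ ^ 2 ≤ ∑ j, ‖v j‖ ^ 2 := by
  have key : ∀ x : ι → ℂ, (star x ⬝ᵥ x) = ((∑ j, ‖x j‖ ^ 2 : ℝ) : ℂ) := by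
    intro x
    simp only [dotProduct, Pi.star_apply, Complex.star_def, Complex.conj_mul']
    push_cast; rfl
  have h := hA.dotProduct_mulVec_nonneg v
  rw [Matrix.sub_mulVec, Matrix.one_mulVec, dotProduct_sub, ← Matrix.mulVec_mulVec,
    Matrix.dotProduct_mulVec, ← Matrix.star_mulVec, key, key, ← Complex.ofReal_sub,
    Complex.zero_le_real, sub_nonneg] at h
  exact h

theorem re_sum_bilin_le {ι : Type*} [Fintype ι] [DecidableEq ι] {M : Matrix ι ι ℂ}
    (hM : (1 - M.conjTranspose * M).PosSemidef) (b a : ι → ℂ) :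
    (∑ i, ∑ j, star (b i) * M j i * a j).re ≤ 1 / 2 * (∑ i, ‖b i‖ ^ 2 + ∑ j, ‖a j‖ ^ 2) := by
  have h := sum_norm_sq_mulVec_le hM (star b)
  simp only [Pi.star_apply, norm_star] at h
  have e : ∑ i, ∑ j, star (b i) * M j i * a j = ∑ j, (∑ i, M j i * star (b i)) * a j := by
    rw [Finset.sum_comm]
    simp only [Finset.sum_mul]
    exact Finset.sum_congr rfl fun i _ => Finset.sum_congr rfl fun j _ => by ring
  rw [e, Complex.re_sum]
  calc ∑ j, ((∑ i, M j i * star (b i)) * a j).re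
      ≤ ∑ j, 1 / 2 * (‖∑ i, M j i * star (b i)‖ ^ 2 + ‖a j‖ ^ 2) := by
        refine Finset.sum_le_sum fun j _ => (Complex.re_le_norm _).trans ?_
        rw [norm_mul]
        nlinarith [sq_nonneg (‖∑ i, M j i * star (b i)‖ - ‖a j‖)]
    _ ≤ _ := by
        rw [← Finset.mul_sum, Finset.sum_add_distrib]
        linarith

/-- The Hermitian matrix with eigenbasis given by the columns of `U` and eigenvalues `l`. -/
def ofSpectrum {ι : Type*} [Fintype ι] [DecidableEq ι] (U : Matrix ι ι ℂ) (l : ι → ℝ) :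
    Matrix ι ι ℂ :=
  U * Matrix.diagonal (fun i => (l i : ℂ)) * U.conjTranspose

theorem trace_mul_ofSpectrum {ι : Type*} [Fintype ι] [DecidableEq ι] (A B U : Matrix ι ι ℂ)
    (l : ι → ℝ) :
    (A.conjTranspose * B * ofSpectrum U l).trace =
      ∑ i, (l i : ℂ) * ∑ k, star ((A * U) k i) * (B * U) k i := by
  have : (A.conjTranspose * B * ofSpectrum U l).trace =
      (Matrix.diagonal (fun i => (l i : ℂ)) * ((A * U).conjTranspose * (B * U))).trace := by
    rw [ofSpectrum, Matrix.mul_assoc U, ← Matrix.mul_assoc, Matrix.trace_mul_comm,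
      Matrix.conjTranspose_mul]
    simp only [Matrix.mul_assoc]
  rw [this, Matrix.trace]
  simp only [Matrix.diag_apply, Matrix.diagonal_mul]
  refine Finset.sum_congr rfl fun i _ => ?_
  rw [Matrix.mul_apply]
  rfl

theorem reTr_mul_ofSpectrum {ι : Type} [Fintype ι] [DecidableEq ι] (A U : Matrix ι ι ℂ)
    (l : ι → ℝ) :
    reTr (A.conjTranspose * A * ofSpectrum U l) = ∑ i, l i * ∑ k, ‖(A * U) k i‖ ^ 2 := by
  rw [reTr, trace_mul_ofSpectrum]
  simp only [Complex.star_def, Complex.conj_mul']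
  norm_cast

open scoped MatrixOrder Matrix.Norms.L2Operator in
theorem exists_eq_conjTranspose_mul_self {ι : Type*} [Fintype ι] [DecidableEq ι]
    {A : Matrix ι ι ℂ} (hA : A.PosSemidef) : ∃ B : Matrix ι ι ℂ, A = B.conjTranspose * B :=
  CStarAlgebra.nonneg_iff_eq_star_mul_self.mp hA.nonneg

theorem test_success_le {ι : Type} [Fintype ι] [DecidableEq ι] {Q U V : Matrix ι ι ℂ}
    (hU : U ∈ Matrix.unitaryGroup ι ℂ) (hV : V ∈ Matrix.unitaryGroup ι ℂ)
    (hQ : Q.PosSemidef) (hQ1 : (1 - Q).PosSemidef) {l m : ι → ℝ} (hl : ∀ i, 0 ≤ l i)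
    (hm : ∀ j, 0 < m j) (hw : ∑ i, ∑ j, l i * ‖(V.conjTranspose * U) j i‖ ^ 2 = 1)
    {D K v : ℝ} (hK : 0 < K) {u : ι → ι → ℝ}
    (hu : ∀ i j, 0 < l i → l i = Real.exp (D + u i j) * m j)
    (hv : ∑ i, ∑ j, l i * ‖(V.conjTranspose * U) j i‖ ^ 2 * u i j ^ 2 ≤ v)
    (hq : reTr (Q * ofSpectrum V m) ≤ Real.exp (-(D + 2 * K))) :
    reTr (Q * ofSpectrum U l) ≤ v / K ^ 2 + Real.exp (-K) := by
  obtain ⟨R, rfl⟩ := exists_eq_conjTranspose_mul_self hQ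
  have hU1 : U.conjTranspose * U = 1 := Matrix.mem_unitaryGroup_iff'.1 hU
  have hV1 : V.conjTranspose * V = 1 := Matrix.mem_unitaryGroup_iff'.1 hV
  have hV2 : V * V.conjTranspose = 1 := Matrix.mem_unitaryGroup_iff.1 hV
  rw [reTr_mul_ofSpectrum] at hq ⊢
  have hM : (1 - (V.conjTranspose * U).conjTranspose * (V.conjTranspose * U)).PosSemidef := by
    have : (V.conjTranspose * U).conjTranspose * (V.conjTranspose * U) = 1 := by
      rw [Matrix.conjTranspose_mul, Matrix.conjTranspose_conjTranspose, Matrix.mul_assoc,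
        ← Matrix.mul_assoc V, hV2, Matrix.one_mul, hU1]
    rw [this, sub_self]
    exact Matrix.PosSemidef.zero
  have hC : (1 - (R * V).conjTranspose * (R * V)).PosSemidef := by
    have : 1 - (R * V).conjTranspose * (R * V)
        = V.conjTranspose * (1 - R.conjTranspose * R) * V := by
      rw [Matrix.mul_sub, Matrix.sub_mul, Matrix.mul_one, hV1, Matrix.conjTranspose_mul]
      simp only [Matrix.mul_assoc]
    rw [this]
    exact hQ1.conjTranspose_mul_mul_same V
  have h := success_le (N := fun i j => (V.conjTranspose * U) j i) (C := R * V)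
    (re_sum_bilin_le hM) (sum_norm_sq_mulVec_le hC) hl hm hw hK hu hv hq
  refine le_trans (le_of_eq ?_) h
  have hRU : R * U = (R * V) * (V.conjTranspose * U) := by
    rw [Matrix.mul_assoc, ← Matrix.mul_assoc V, hV2, Matrix.one_mul]
  rw [hRU]
  rfl

theorem isHermitian_cfc_eq {d : ℕ} {A : Matrix (Fin d) (Fin d) ℂ} (hA : A.IsHermitian)
    (f : ℝ → ℝ) :
    hA.cfc f = ofSpectrum (hA.eigenvectorUnitary : Matrix (Fin d) (Fin d) ℂ)
      (fun i => f (hA.eigenvalues i)) := by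
  rw [Matrix.IsHermitian.cfc, Unitary.conjStarAlgAut_apply]
  rfl

theorem eq_ofSpectrum {d : ℕ} {A : Matrix (Fin d) (Fin d) ℂ} (hA : A.IsHermitian) :
    A = ofSpectrum (hA.eigenvectorUnitary : Matrix (Fin d) (Fin d) ℂ) hA.eigenvalues := by
  conv_lhs => rw [hA.spectral_theorem, Unitary.conjStarAlgAut_apply]
  rfl

theorem isHermitian_ofSpectrum {ι : Type*} [Fintype ι] [DecidableEq ι] (U : Matrix ι ι ℂ)
    (l : ι → ℝ) : (ofSpectrum U l).IsHermitian := by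
  rw [ofSpectrum]
  refine Matrix.isHermitian_mul_mul_conjTranspose _ ?_
  rw [Matrix.IsHermitian, Matrix.diagonal_conjTranspose]
  congr 1
  funext i
  exact Complex.conj_ofReal _

/-- Overlaps of the eigenvectors of `σ` with those of `ρ`. -/
def overlap {d : ℕ} {ρ σ : Matrix (Fin d) (Fin d) ℂ} (hρ : ρ.IsHermitian) (hσ : σ.IsHermitian) :
    Matrix (Fin d) (Fin d) ℂ :=
  (hσ.eigenvectorUnitary : Matrix (Fin d) (Fin d) ℂ).conjTranspose *
    (hρ.eigenvectorUnitary : Matrix (Fin d) (Fin d) ℂ)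

theorem overlap_log_sub {d : ℕ} {ρ σ : Matrix (Fin d) (Fin d) ℂ} (hρ : ρ.IsHermitian)
    (hσ : σ.IsHermitian) (i j : Fin d) :
    ((hσ.eigenvectorUnitary : Matrix (Fin d) (Fin d) ℂ).conjTranspose * (mlog ρ - mlog σ) *
      (hρ.eigenvectorUnitary : Matrix (Fin d) (Fin d) ℂ)) j i =
    ((Real.log (hρ.eigenvalues i) - Real.log (hσ.eigenvalues j) : ℝ) : ℂ) *
      overlap hρ hσ j i := by
  have hU1 : (hρ.eigenvectorUnitary : Matrix (Fin d) (Fin d) ℂ).conjTranspose *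
      (hρ.eigenvectorUnitary : Matrix (Fin d) (Fin d) ℂ) = 1 :=
    Matrix.mem_unitaryGroup_iff'.1 hρ.eigenvectorUnitary.2
  have hV1 : (hσ.eigenvectorUnitary : Matrix (Fin d) (Fin d) ℂ).conjTranspose *
      (hσ.eigenvectorUnitary : Matrix (Fin d) (Fin d) ℂ) = 1 :=
    Matrix.mem_unitaryGroup_iff'.1 hσ.eigenvectorUnitary.2
  rw [mlog, mlog, matFun, matFun, dif_pos hρ, dif_pos hσ, isHermitian_cfc_eq, isHermitian_cfc_eq,
    overlap]
  generalize (hρ.eigenvectorUnitary : Matrix (Fin d) (Fin d) ℂ) = U at *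
  generalize (hσ.eigenvectorUnitary : Matrix (Fin d) (Fin d) ℂ) = V at *
  have : V.conjTranspose * (ofSpectrum U (fun i => Real.log (hρ.eigenvalues i)) -
      ofSpectrum V (fun i => Real.log (hσ.eigenvalues i))) * U =
      (V.conjTranspose * U) * Matrix.diagonal (fun i => (Real.log (hρ.eigenvalues i) : ℂ)) -
      Matrix.diagonal (fun i => (Real.log (hσ.eigenvalues i) : ℂ)) * (V.conjTranspose * U) := by
    rw [Matrix.mul_sub, Matrix.sub_mul, ofSpectrum, ofSpectrum]
    congr 1
    · simp only [Matrix.mul_assoc, hU1, Matrix.mul_one]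
    · simp only [← Matrix.mul_assoc, hV1, Matrix.one_mul]
  rw [this, Matrix.sub_apply, Matrix.mul_diagonal, Matrix.diagonal_mul]
  push_cast
  ring

theorem qD_eq_sum {d : ℕ} {ρ σ : Matrix (Fin d) (Fin d) ℂ} (hρ : ρ.IsHermitian)
    (hσ : σ.IsHermitian) :
    qD ρ σ = ∑ i, ∑ j, hρ.eigenvalues i * ‖overlap hρ hσ j i‖ ^ 2 *
      (Real.log (hρ.eigenvalues i) - Real.log (hσ.eigenvalues j)) := by
  have hV2 : (hσ.eigenvectorUnitary : Matrix (Fin d) (Fin d) ℂ) *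
      (hσ.eigenvectorUnitary : Matrix (Fin d) (Fin d) ℂ).conjTranspose = 1 :=
    Matrix.mem_unitaryGroup_iff.1 hσ.eigenvectorUnitary.2
  have h := trace_mul_ofSpectrum
    (hσ.eigenvectorUnitary : Matrix (Fin d) (Fin d) ℂ).conjTranspose
    ((hσ.eigenvectorUnitary : Matrix (Fin d) (Fin d) ℂ).conjTranspose * (mlog ρ - mlog σ))
    (hρ.eigenvectorUnitary : Matrix (Fin d) (Fin d) ℂ) hρ.eigenvalues
  rw [Matrix.conjTranspose_conjTranspose, ← Matrix.mul_assoc, hV2, Matrix.one_mul,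
    ← eq_ofSpectrum, Matrix.trace_mul_comm] at h
  rw [qD, reTr, h, Complex.re_sum]
  refine Finset.sum_congr rfl fun i _ => ?_
  rw [Complex.re_ofReal_mul, Complex.re_sum, Finset.mul_sum]
  refine Finset.sum_congr rfl fun j _ => ?_
  rw [overlap_log_sub, ← overlap, mul_left_comm, Complex.re_ofReal_mul, Complex.star_def,
    Complex.conj_mul', ← Complex.ofReal_pow, Complex.ofReal_re]
  ring

theorem qV_add_sq_eq_sum {d : ℕ} {ρ σ : Matrix (Fin d) (Fin d) ℂ} (hρ : ρ.IsHermitian)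
    (hσ : σ.IsHermitian) :
    qV ρ σ + qD ρ σ ^ 2 = ∑ i, ∑ j, hρ.eigenvalues i * ‖overlap hρ hσ j i‖ ^ 2 *
      (Real.log (hρ.eigenvalues i) - Real.log (hσ.eigenvalues j)) ^ 2 := by
  have hV2 : (hσ.eigenvectorUnitary : Matrix (Fin d) (Fin d) ℂ) *
      (hσ.eigenvectorUnitary : Matrix (Fin d) (Fin d) ℂ).conjTranspose = 1 :=
    Matrix.mem_unitaryGroup_iff.1 hσ.eigenvectorUnitary.2
  have hX : (mlog ρ - mlog σ).conjTranspose = mlog ρ - mlog σ := by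
    have : ∀ {A : Matrix (Fin d) (Fin d) ℂ} (hA : A.IsHermitian), (mlog A).IsHermitian := by
      intro A hA
      rw [mlog, matFun, dif_pos hA, isHermitian_cfc_eq]
      exact isHermitian_ofSpectrum _ _
    exact (this hρ).sub (this hσ)
  have h := reTr_mul_ofSpectrum
    ((hσ.eigenvectorUnitary : Matrix (Fin d) (Fin d) ℂ).conjTranspose * (mlog ρ - mlog σ))
    (hρ.eigenvectorUnitary : Matrix (Fin d) (Fin d) ℂ) hρ.eigenvalues
  rw [Matrix.conjTranspose_mul, Matrix.conjTranspose_conjTranspose, hX, Matrix.mul_assoc (mlog ρ - mlog σ),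
    ← Matrix.mul_assoc _ _ (mlog ρ - mlog σ), hV2, Matrix.one_mul, ← eq_ofSpectrum, ← sq] at h
  rw [qV, sub_add_cancel, reTr, Matrix.trace_mul_comm, ← reTr, h]
  refine Finset.sum_congr rfl fun i _ => ?_
  rw [Finset.mul_sum]
  refine Finset.sum_congr rfl fun j _ => ?_
  rw [overlap_log_sub, norm_mul, mul_pow, Complex.norm_real, Real.norm_eq_abs, sq_abs]
  ring

theorem sum_eigenvalues_mul_overlap {d : ℕ} {ρ σ : Matrix (Fin d) (Fin d) ℂ} (hρ : ρ.IsHermitian)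
    (hσ : σ.IsHermitian) :
    ∑ i, ∑ j, hρ.eigenvalues i * ‖overlap hρ hσ j i‖ ^ 2 = reTr ρ := by
  have hV2 : (hσ.eigenvectorUnitary : Matrix (Fin d) (Fin d) ℂ) *
      (hσ.eigenvectorUnitary : Matrix (Fin d) (Fin d) ℂ).conjTranspose = 1 :=
    Matrix.mem_unitaryGroup_iff.1 hσ.eigenvectorUnitary.2
  have h := reTr_mul_ofSpectrum
    (hσ.eigenvectorUnitary : Matrix (Fin d) (Fin d) ℂ).conjTranspose
    (hρ.eigenvectorUnitary : Matrix (Fin d) (Fin d) ℂ) hρ.eigenvalues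
  rw [Matrix.conjTranspose_conjTranspose, hV2, Matrix.one_mul, ← eq_ofSpectrum] at h
  rw [h]
  exact Finset.sum_congr rfl fun i _ => (Finset.mul_sum _ _ _).symm

theorem sum_prod_mul_sum_sq {α : Type*} [Fintype α] {n : ℕ} {w f : Fin n → α → ℝ}
    (hw : ∀ k, ∑ a, w k a = 1) (hf : ∀ k, ∑ a, w k a * f k a = 0) :
    ∑ x : Fin n → α, (∏ k, w k (x k)) * (∑ k, f k (x k)) ^ 2 =
      ∑ k, ∑ a, w k a * f k a ^ 2 := by
  classical
  have key : ∀ k l, ∑ x : Fin n → α, (∏ r, w r (x r)) * (f k (x k) * f l (x l)) =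
      if k = l then ∑ a, w k a * f k a ^ 2 else 0 := by
    intro k l
    have h1 : ∀ x : Fin n → α, (∏ r, w r (x r)) * (f k (x k) * f l (x l)) =
        ∏ r, (w r (x r) * ((if r = k then f r (x r) else 1) * (if r = l then f r (x r) else 1))) := by
      intro x
      rw [Finset.prod_mul_distrib, Finset.prod_mul_distrib, Fintype.prod_ite_eq',
        Fintype.prod_ite_eq']
    simp only [h1]
    rw [← Fintype.piFinset_univ, ← Finset.prod_univ_sum (fun _ => Finset.univ)
      (fun r a => w r a * ((if r = k then f r a else 1) * (if r = l then f r a else 1)))]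
    split_ifs with h
    · subst h
      rw [Finset.prod_eq_single k]
      · simp [sq]
      · intro r _ hr
        simp [hr, hw]
      · simp
    · apply Finset.prod_eq_zero (Finset.mem_univ k)
      simp [h, hf]
  have hexpand : ∀ x : Fin n → α, (∏ k, w k (x k)) * (∑ k, f k (x k)) ^ 2 =
      ∑ k, ∑ l, (∏ r, w r (x r)) * (f k (x k) * f l (x l)) := fun x => by
    rw [sq, Finset.sum_mul_sum]
    simp only [Finset.mul_sum]
  simp only [hexpand]
  rw [Finset.sum_comm]
  refine Finset.sum_congr rfl fun k _ => ?_
  rw [Finset.sum_comm]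
  simp only [key, Finset.sum_ite_eq, Finset.mem_univ, if_true]

theorem sum_sum_eq_sum_prod {α β M : Type*} [Fintype α] [Fintype β] [AddCommMonoid M] {n : ℕ}
    (g : (Fin n → α × β) → M) :
    ∑ i : Fin n → α, ∑ j : Fin n → β, g (fun k => (i k, j k)) = ∑ x, g x := by
  classical
  refine (Fintype.sum_prod_type' fun (i : Fin n → α) (j : Fin n → β) =>
    g fun k => (i k, j k)).symm.trans ?_
  exact Fintype.sum_equiv (Equiv.arrowProdEquivProdArrow (Fin n) (fun _ => α) (fun _ => β)).symm _ _
    fun _ => rfl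

theorem tensorSeq_mul {d n : ℕ} (A B : Fin n → Matrix (Fin d) (Fin d) ℂ) :
    tensorSeq A * tensorSeq B = tensorSeq fun k => A k * B k := by
  ext i j
  simp only [Matrix.mul_apply, tensorSeq, Matrix.of_apply, ← Finset.prod_mul_distrib]
  rw [Finset.prod_univ_sum, Fintype.piFinset_univ]

theorem conjTranspose_tensorSeq {d n : ℕ} (A : Fin n → Matrix (Fin d) (Fin d) ℂ) :
    (tensorSeq A).conjTranspose = tensorSeq fun k => (A k).conjTranspose := by
  ext i j
  simp [tensorSeq, Matrix.conjTranspose_apply]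

theorem tensorSeq_diagonal {d n : ℕ} (l : Fin n → Fin d → ℂ) :
    tensorSeq (fun k => Matrix.diagonal (l k)) = Matrix.diagonal fun i => ∏ k, l k (i k) := by
  ext i j
  simp only [tensorSeq, Matrix.of_apply, Matrix.diagonal_apply]
  split_ifs with h
  · simp [h]
  · obtain ⟨k, hk⟩ := Function.ne_iff.1 h
    exact Finset.prod_eq_zero (Finset.mem_univ k) (by simp [hk])

theorem tensorSeq_one {d n : ℕ} :
    tensorSeq (fun _ : Fin n => (1 : Matrix (Fin d) (Fin d) ℂ)) = 1 := by
  have := tensorSeq_diagonal (fun (_ : Fin n) (_ : Fin d) => (1 : ℂ))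
  simpa only [Finset.prod_const_one, Matrix.diagonal_one] using this

theorem trace_tensorSeq {d n : ℕ} (A : Fin n → Matrix (Fin d) (Fin d) ℂ) :
    (tensorSeq A).trace = ∏ k, (A k).trace := by
  simp only [Matrix.trace, Matrix.diag_apply, tensorSeq, Matrix.of_apply]
  rw [Finset.prod_univ_sum, Fintype.piFinset_univ]

theorem tensorSeq_ofSpectrum {d n : ℕ} (U : Fin n → Matrix (Fin d) (Fin d) ℂ)
    (l : Fin n → Fin d → ℝ) :
    tensorSeq (fun k => ofSpectrum (U k) (l k)) =
      ofSpectrum (tensorSeq U) fun i => ∏ k, l k (i k) := by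
  simp only [ofSpectrum, ← tensorSeq_mul, conjTranspose_tensorSeq, tensorSeq_diagonal]
  push_cast
  rfl

theorem tensorSeq_mem_unitaryGroup {d n : ℕ} {U : Fin n → Matrix (Fin d) (Fin d) ℂ}
    (hU : ∀ k, U k ∈ Matrix.unitaryGroup (Fin d) ℂ) :
    tensorSeq U ∈ Matrix.unitaryGroup (Fin n → Fin d) ℂ := by
  rw [Matrix.mem_unitaryGroup_iff]
  change tensorSeq U * (tensorSeq U).conjTranspose = 1
  rw [conjTranspose_tensorSeq, tensorSeq_mul, ← tensorSeq_one]
  congr 1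
  funext k
  exact Matrix.mem_unitaryGroup_iff.1 (hU k)

theorem test_tensorSeq_success_le {d n : ℕ} {ρ : Fin n → Matrix (Fin d) (Fin d) ℂ}
    (hρ : ∀ k, IsDensity (ρ k)) {σ : Matrix (Fin d) (Fin d) ℂ} (hσ : σ.PosDef)
    {Q : Matrix (Fin n → Fin d) (Fin n → Fin d) ℂ} (hQ : Q.PosSemidef)
    (hQ1 : (1 - Q).PosSemidef) {K : ℝ} (hK : 0 < K)
    (hq : reTr (Q * tensorPow σ n) ≤ Real.exp (-(∑ k, qD (ρ k) σ + 2 * K))) :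
    reTr (Q * tensorSeq ρ) ≤ (∑ k, qV (ρ k) σ) / K ^ 2 + Real.exp (-K) := by
  have hρh : ∀ k, (ρ k).IsHermitian := fun k => (hρ k).1.1
  have hσh : σ.IsHermitian := hσ.1
  set U : Fin n → Matrix (Fin d) (Fin d) ℂ := fun k => ((hρh k).eigenvectorUnitary : Matrix _ _ ℂ)
    with hU
  set V : Fin n → Matrix (Fin d) (Fin d) ℂ := fun _ => (hσh.eigenvectorUnitary : Matrix _ _ ℂ)
    with hV
  set lam : Fin n → Fin d → ℝ := fun k => (hρh k).eigenvalues with hlam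
  set mu : Fin d → ℝ := hσh.eigenvalues with hmu
  have hlam0 : ∀ k i, 0 ≤ lam k i := fun k i => (hρ k).1.eigenvalues_nonneg i
  have hmu0 : ∀ j, 0 < mu j := fun j => hσ.eigenvalues_pos j
  have eρ : tensorSeq ρ = ofSpectrum (tensorSeq U) fun i => ∏ k, lam k (i k) := by
    rw [← tensorSeq_ofSpectrum]
    exact congrArg tensorSeq (funext fun k => eq_ofSpectrum (hρh k))
  have eσ : tensorPow σ n = ofSpectrum (tensorSeq V) fun j => ∏ k, mu (j k) := by
    rw [tensorPow, ← tensorSeq_ofSpectrum V fun _ => mu]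
    exact congrArg tensorSeq (funext fun k => eq_ofSpectrum hσh)
  set w : Fin n → Fin d × Fin d → ℝ := fun k p =>
    lam k p.1 * ‖overlap (hρh k) hσh p.2 p.1‖ ^ 2 with hwdef
  set f : Fin n → Fin d × Fin d → ℝ := fun k p =>
    Real.log (lam k p.1) - Real.log (mu p.2) - qD (ρ k) σ with hf
  have hw1 : ∀ k, ∑ a, w k a = 1 := by
    intro k
    rw [Fintype.sum_prod_type]
    refine (sum_eigenvalues_mul_overlap (hρh k) hσh).trans ?_
    rw [reTr, (hρ k).2, Complex.one_re]
  have hD : ∀ k, ∑ a, w k a * (Real.log (lam k a.1) - Real.log (mu a.2)) = qD (ρ k) σ := by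
    intro k
    rw [Fintype.sum_prod_type, qD_eq_sum (hρh k) hσh]
  have hf0 : ∀ k, ∑ a, w k a * f k a = 0 := by
    intro k
    simp only [hf, mul_sub _ _ (qD (ρ k) σ), Finset.sum_sub_distrib, hD, ← Finset.sum_mul, hw1,
      one_mul, sub_self]
  have hf2 : ∀ k, ∑ a, w k a * f k a ^ 2 = qV (ρ k) σ := by
    intro k
    have h2 : ∑ a, w k a * (Real.log (lam k a.1) - Real.log (mu a.2)) ^ 2
        = qV (ρ k) σ + qD (ρ k) σ ^ 2 := by
      rw [Fintype.sum_prod_type, qV_add_sq_eq_sum (hρh k) hσh]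
    have e : ∀ a, w k a * f k a ^ 2 = w k a * (Real.log (lam k a.1) - Real.log (mu a.2)) ^ 2
        - 2 * qD (ρ k) σ * (w k a * (Real.log (lam k a.1) - Real.log (mu a.2)))
        + qD (ρ k) σ ^ 2 * w k a := fun a => by rw [hf]; ring
    simp only [e, Finset.sum_add_distrib, Finset.sum_sub_distrib, ← Finset.mul_sum, h2, hD, hw1]
    ring
  have hoverlap : ∀ i j : Fin n → Fin d,
      (∏ k, lam k (i k)) * ‖((tensorSeq V).conjTranspose * tensorSeq U) j i‖ ^ 2 =
      ∏ k, w k (i k, j k) := by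
    intro i j
    rw [conjTranspose_tensorSeq, tensorSeq_mul]
    simp only [tensorSeq, Matrix.of_apply, norm_prod, ← Finset.prod_pow,
      ← Finset.prod_mul_distrib]
    rfl
  rw [eσ] at hq
  rw [eρ]
  refine test_success_le (U := tensorSeq U) (V := tensorSeq V) (D := ∑ k, qD (ρ k) σ) (u := fun i j => ∑ k, f k (i k, j k))
    (tensorSeq_mem_unitaryGroup fun k => (hρh k).eigenvectorUnitary.2)
    (tensorSeq_mem_unitaryGroup fun k => hσh.eigenvectorUnitary.2) hQ hQ1
    (fun i => Finset.prod_nonneg fun k _ => hlam0 _ _)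
    (fun j => Finset.prod_pos fun k _ => hmu0 _) ?_ hK ?_ ?_ hq
  · refine (Finset.sum_congr rfl fun i _ => Finset.sum_congr rfl fun j _ => hoverlap i j).trans ?_
    rw [sum_sum_eq_sum_prod fun x => ∏ k, w k (x k), ← Fintype.piFinset_univ,
      ← Finset.prod_univ_sum]
    simp [hw1]
  · intro i j hi
    have hpos : ∀ k, 0 < lam k (i k) := fun k =>
      (hlam0 k _).lt_of_ne' (Finset.prod_ne_zero_iff.1 hi.ne' k (Finset.mem_univ k))
    rw [← Finset.sum_add_distrib, Real.exp_sum, ← Finset.prod_mul_distrib]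
    refine Finset.prod_congr rfl fun k _ => ?_
    rw [hf]
    simp only [add_sub_cancel]
    rw [Real.exp_sub, Real.exp_log (hpos k), Real.exp_log (hmu0 _), div_mul_cancel₀ _ (hmu0 _).ne']
  · refine (Finset.sum_congr rfl fun i _ => Finset.sum_congr rfl fun j _ =>
      congrArg (· * (∑ k, f k (i k, j k)) ^ 2) (hoverlap i j)).trans_le ?_
    rw [sum_sum_eq_sum_prod fun x => (∏ k, w k (x k)) * (∑ k, f k (x k)) ^ 2,
      sum_prod_mul_sum_sq hw1 hf0]
    simp only [hf2, le_refl]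

theorem reTr_mul_tensorSeq_nonneg {d n : ℕ} {ρ : Fin n → Matrix (Fin d) (Fin d) ℂ}
    (hρ : ∀ k, (ρ k).PosSemidef) {Q : Matrix (Fin n → Fin d) (Fin n → Fin d) ℂ}
    (hQ : Q.PosSemidef) : 0 ≤ reTr (Q * tensorSeq ρ) := by
  obtain ⟨R, rfl⟩ := exists_eq_conjTranspose_mul_self hQ
  rw [show ρ = _ from funext fun k => eq_ofSpectrum (hρ k).1, tensorSeq_ofSpectrum,
    reTr_mul_ofSpectrum]
  exact Finset.sum_nonneg fun i _ => mul_nonneg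
    (Finset.prod_nonneg fun k _ => (hρ k).eigenvalues_nonneg _) (by positivity)

/-- **Wolfowitz-type strong converse for binary quantum hypothesis testing. ** -/
theorem wolfowitz_strong_converse
    {X : Type} [Fintype X] {d : ℕ}
    (Wb : X → Matrix (Fin d) (Fin d) ℂ) (hW : ∀ x, IsDensity (Wb x))
    (σ : Matrix (Fin d) (Fin d) ℂ) (hσ : σ.PosDef ∧ σ.trace = 1)
    {n : ℕ} (xs : Fin n → X) (R κ : ℝ) (hκ : 0 < κ)
    (A : ℝ) (hA : A = ⨆ x, qV (Wb x) σ)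
    (Q : Matrix (Fin n → Fin d) (Fin n → Fin d) ℂ)
    (hQ₁ : Q.PosSemidef) (hQ₂ : (1 - Q).PosSemidef)
    (hβ : reTr (Q * tensorPow σ n) ≤ Real.exp (-(n : ℝ) * R))
    (hD : (1 / (n : ℝ)) * ∑ i, qD (Wb (xs i)) σ ≤ R - 2 * κ) :
    reTr ((1 - Q) * tensorSeq fun k => Wb (xs k)) ≥
      1 - A / ((n : ℝ) * κ ^ 2) - Real.exp (-(n : ℝ) * κ) := by
  rcases Nat.eq_zero_or_pos n with hn | hn
  · have h := reTr_mul_tensorSeq_nonneg (fun k => (hW (xs k)).1) hQ₂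
    have hn0 : (n : ℝ) = 0 := by exact_mod_cast hn
    simp only [hn0, zero_mul, div_zero, neg_zero, Real.exp_zero]
    linarith
  have hn0 : (0 : ℝ) < n := by exact_mod_cast hn
  have hsum : ∑ i, qD (Wb (xs i)) σ ≤ n * (R - 2 * κ) := by
    rwa [one_div, inv_mul_le_iff₀ hn0] at hD
  have hV : ∑ k, qV (Wb (xs k)) σ ≤ n * A := by
    have : ∀ k, qV (Wb (xs k)) σ ≤ A := fun k => by
      rw [hA]
      exact le_ciSup (f := fun x => qV (Wb x) σ) (Set.finite_range _).bddAbove (xs k)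
    simpa using Finset.sum_le_sum fun k (_ : k ∈ Finset.univ) => this k
  have h := test_tensorSeq_success_le (fun k => hW (xs k)) hσ.1 hQ₁ hQ₂ (mul_pos hn0 hκ)
    (hβ.trans (Real.exp_le_exp.2 (by linarith)))
  have hV2 : (∑ k, qV (Wb (xs k)) σ) / (n * κ) ^ 2 ≤ A / (n * κ ^ 2) := by
    rw [show A / (n * κ ^ 2) = n * A / (n * κ) ^ 2 by field_simp]
    gcongr
  have ht : reTr ((1 - Q) * tensorSeq fun k => Wb (xs k)) =
      1 - reTr (Q * tensorSeq fun k => Wb (xs k)) := by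
    rw [reTr, Matrix.sub_mul, Matrix.one_mul, Matrix.trace_sub, trace_tensorSeq, Complex.sub_re]
    simp [(hW _).2, reTr]
  rw [ht, neg_mul]
  linarith

end MDQ
end
end

section
/- Concavity of the modified auxiliary function Ẽ_0: Let W be a classical-quantum channel with finite input alphabet X whose outputs W_x are positive definite density operators on ℂ^d, let σ be a positive definite density operator on ℂ^d, and let P be a probability distribution on X. Then the function s ↦ Ẽ_0(s,P,σ) := −log Σ_{x∈X} P(x)·Tr[W_x^{1−s} σ^s] is concave on [0, +∞). -/
open scoped BigOperators ComplexOrder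
open Filter

noncomputable section

namespace MDQ

/-- A nonnegative combination of exponentials of affine functions is log-convex. -/
lemma convexOn_log_sum_mul_exp {ι : Type*} [Fintype ι] (c α β : ι → ℝ) (hc : ∀ k, 0 ≤ c k) :
    ConvexOn ℝ Set.univ (fun s : ℝ => Real.log (∑ k, c k * Real.exp (α k + β k * s))) := by
  set F : ℝ → ℝ := fun s => ∑ k, c k * Real.exp (α k + β k * s) with hF
  change ConvexOn ℝ Set.univ (fun s => Real.log (F s))
  by_cases hzero : ∀ k, c k = 0
  · have : (fun s => Real.log (F s)) = fun _ => 0 := by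
      funext s
      simp [hF, hzero]
    rw [this]
    exact convexOn_const 0 convex_univ
  · obtain ⟨k₀, hk₀⟩ := not_forall.mp hzero
    have hpos : ∀ s, 0 < F s := fun s =>
      Finset.sum_pos' (fun k _ => mul_nonneg (hc k) (Real.exp_pos _).le)
        ⟨k₀, Finset.mem_univ _, mul_pos ((hc k₀).lt_of_ne' hk₀) (Real.exp_pos _)⟩
    refine ⟨convex_univ, fun s _ t _ a b ha hb hab => ?_⟩
    simp only [smul_eq_mul]
    rw [Real.log_le_iff_le_exp (hpos _)]
    have hterm : ∀ k, c k * Real.exp (α k + β k * (a * s + b * t)) ≤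
        Real.exp (a * Real.log (F s) + b * Real.log (F t)) *
          (a * (c k * Real.exp (α k + β k * s) / F s) +
            b * (c k * Real.exp (α k + β k * t) / F t)) := by
      intro k
      have h := convexOn_exp.2 (Set.mem_univ (α k + β k * s - Real.log (F s)))
        (Set.mem_univ (α k + β k * t - Real.log (F t))) ha hb hab
      simp only [smul_eq_mul, Real.exp_sub, Real.exp_log (hpos _)] at h
      have he : Real.exp (α k + β k * (a * s + b * t)) =
          Real.exp (a * Real.log (F s) + b * Real.log (F t)) *
          Real.exp (a * (α k + β k * s - Real.log (F s)) +
            b * (α k + β k * t - Real.log (F t))) := by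
        rw [← Real.exp_add]
        congr 1
        linear_combination (-α k) * hab
      rw [he]
      calc _ = c k * Real.exp (a * Real.log (F s) + b * Real.log (F t)) *
            Real.exp (a * (α k + β k * s - Real.log (F s)) +
              b * (α k + β k * t - Real.log (F t))) := by ring
        _ ≤ c k * Real.exp (a * Real.log (F s) + b * Real.log (F t)) * _ :=
          mul_le_mul_of_nonneg_left h (mul_nonneg (hc k) (Real.exp_pos _).le)
        _ = _ := by ring
    refine (Finset.sum_le_sum fun k _ => hterm k).trans_eq ?_
    rw [← Finset.mul_sum, Finset.sum_add_distrib, ← Finset.mul_sum, ← Finset.mul_sum,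
      ← Finset.sum_div, ← Finset.sum_div, div_self (hpos s).ne', div_self (hpos t).ne',
      mul_one, mul_one, hab, mul_one]

/-- The overlap `|⟨uᵢ, vⱼ⟩|²` between the eigenvectors of two Hermitian matrices. -/
def eigenOverlap {d : ℕ} {A B : Matrix (Fin d) (Fin d) ℂ} (hA : A.IsHermitian)
    (hB : B.IsHermitian) (i j : Fin d) : ℝ :=
  Complex.normSq ((star (hA.eigenvectorUnitary : Matrix (Fin d) (Fin d) ℂ) *
    (hB.eigenvectorUnitary : Matrix (Fin d) (Fin d) ℂ)) i j)

lemma reTr_matFun_mul_matFun {d : ℕ} {A B : Matrix (Fin d) (Fin d) ℂ} (hA : A.IsHermitian)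
    (hB : B.IsHermitian) (f g : ℝ → ℝ) :
    reTr (matFun f A * matFun g B) =
      ∑ i, ∑ j, f (hA.eigenvalues i) * g (hB.eigenvalues j) * eigenOverlap hA hB i j := by
  simp only [matFun, dif_pos hA, dif_pos hB, Matrix.IsHermitian.cfc,
    Unitary.conjStarAlgAut_apply, reTr, eigenOverlap]
  set U := (hA.eigenvectorUnitary : Matrix (Fin d) (Fin d) ℂ)
  set V := (hB.eigenvectorUnitary : Matrix (Fin d) (Fin d) ℂ)
  set D := Matrix.diagonal (RCLike.ofReal ∘ f ∘ hA.eigenvalues : Fin d → ℂ) with hD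
  set E := Matrix.diagonal (RCLike.ofReal ∘ g ∘ hB.eigenvalues : Fin d → ℂ) with hE
  have h : (U * D * star U * (V * E * star V)).trace =
      (D * (star U * V) * (E * star (star U * V))).trace := by
    rw [star_mul, star_star, show U * D * star U * (V * E * star V) =
      U * (D * (star U * V) * (E * star V)) by simp only [mul_assoc], Matrix.trace_mul_comm]
    simp only [mul_assoc]
  rw [h]
  generalize star U * V = M
  simp only [Matrix.trace, Matrix.diag, Matrix.mul_apply (M := D * M), Complex.re_sum]
  refine Finset.sum_congr rfl fun i _ => Finset.sum_congr rfl fun j _ => ?_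
  rw [hD, hE, Matrix.diagonal_mul, Matrix.diagonal_mul, Matrix.star_apply]
  have hn := Complex.mul_conj (M i j)
  rw [show star (M i j) = (starRingEnd ℂ) (M i j) from rfl]
  have : ((RCLike.ofReal ∘ f ∘ hA.eigenvalues) i : ℂ) * M i j *
      ((RCLike.ofReal ∘ g ∘ hB.eigenvalues) j * (starRingEnd ℂ) (M i j)) =
      ((f (hA.eigenvalues i) * g (hB.eigenvalues j) * Complex.normSq (M i j) : ℝ) : ℂ) := by
    push_cast
    rw [← hn]
    simp only [Function.comp_apply, Complex.coe_algebraMap]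
    ring
  rw [this, Complex.ofReal_re]

lemma reTr_mpow_mul_mpow {d : ℕ} {A B : Matrix (Fin d) (Fin d) ℂ} (hA : A.PosDef)
    (hB : B.PosDef) (p q : ℝ) :
    reTr (mpow A p * mpow B q) =
      ∑ i, ∑ j, eigenOverlap hA.isHermitian hB.isHermitian i j *
        Real.exp (Real.log (hA.isHermitian.eigenvalues i) * p +
          Real.log (hB.isHermitian.eigenvalues j) * q) := by
  rw [mpow, mpow, reTr_matFun_mul_matFun hA.isHermitian hB.isHermitian]
  refine Finset.sum_congr rfl fun i _ => Finset.sum_congr rfl fun j _ => ?_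
  have hi := hA.eigenvalues_pos i
  have hj := hB.eigenvalues_pos j
  rw [if_neg hi.ne', if_neg hj.ne', Real.rpow_def_of_pos hi, Real.rpow_def_of_pos hj,
    Real.exp_add, mul_comm]

/-- **Concavity of the modified auxiliary function `Ẽ₀`.** -/
theorem E0Tilde_concaveOn
    {X : Type} [Fintype X] {d : ℕ}
    (W : X → Matrix (Fin d) (Fin d) ℂ) (hW : ∀ x, (W x).PosDef ∧ (W x).trace = 1)
    (σ : Matrix (Fin d) (Fin d) ℂ) (hσ : σ.PosDef ∧ σ.trace = 1)
    (P : X → ℝ) (hP : IsProbDist P) :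
    ConcaveOn ℝ (Set.Ici 0) (fun s => E0Tilde W s P σ) := by
  have hconv := convexOn_log_sum_mul_exp
    (fun k : X × Fin d × Fin d => P k.1 *
      eigenOverlap (hW k.1).1.isHermitian hσ.1.isHermitian k.2.1 k.2.2)
    (fun k => Real.log ((hW k.1).1.isHermitian.eigenvalues k.2.1))
    (fun k => Real.log (hσ.1.isHermitian.eigenvalues k.2.2) -
      Real.log ((hW k.1).1.isHermitian.eigenvalues k.2.1))
    (fun k => mul_nonneg (hP.1 k.1) (Complex.normSq_nonneg _))
  refine (hconv.neg.subset (Set.subset_univ _) (convex_Ici 0)).congr fun s _ => ?_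
  simp only [Pi.neg_apply, E0Tilde, Fintype.sum_prod_type]
  congr 2
  refine Finset.sum_congr rfl fun x _ => ?_
  rw [reTr_mpow_mul_mpow (hW x).1 hσ.1, Finset.mul_sum]
  refine Finset.sum_congr rfl fun i _ => ?_
  rw [Finset.mul_sum]
  refine Finset.sum_congr rfl fun j _ => ?_
  rw [mul_assoc]
  congr 3
  ring

end MDQ
end
end

section
/- First derivative of the modified auxiliary function Ẽ_0 at s = 0: Let W be a classical-quantum channel with finite input alphabet X whose outputs W_x are positive definite density operators on ℂ^d, let σ be a positive definite density operator on ℂ^d, and let P be a probability distribution on X. Then the function s ↦ Ẽ_0(s,P,σ) := −log Σ_{x∈X} P(x)·Tr[W_x^{1−s} σ^s] is differentiable at s = 0 and its derivative there equals Σ_{x∈X} P(x)·D(W_x‖σ). -/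
open scoped BigOperators ComplexOrder
open Filter

noncomputable section

namespace MDQ

/-- If `fun s => f s t` has derivative `f' t` for every eigenvalue `t` of `A`, then every entry of
`fun s => matFun (f s) A` is differentiable, with derivative the entry of `matFun f' A`. -/
lemma hasDerivAt_matFun_apply {d : ℕ} {A : Matrix (Fin d) (Fin d) ℂ} (hA : A.IsHermitian)
    {f : ℝ → ℝ → ℝ} {f' : ℝ → ℝ} {s : ℝ}
    (hf : ∀ k, HasDerivAt (fun u => f u (hA.eigenvalues k)) (f' (hA.eigenvalues k)) s)
    (i j : Fin d) :
    HasDerivAt (fun u => matFun (f u) A i j) (matFun f' A i j) s := by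
  simp only [matFun, hA, dif_pos, Matrix.IsHermitian.cfc, Unitary.conjStarAlgAut_apply]
  simp only [Matrix.mul_apply (N := star _), Matrix.mul_diagonal, Function.comp_apply]
  exact HasDerivAt.fun_sum fun k _ => ((hf k).ofReal_comp.const_mul _).mul_const _

lemma matFun_eq_cfc {d : ℕ} {A : Matrix (Fin d) (Fin d) ℂ} (hA : A.IsHermitian) (f : ℝ → ℝ) :
    matFun f A = cfc f A := by
  rw [matFun, dif_pos hA, hA.cfc_eq]

lemma spectrum_pos {d : ℕ} {A : Matrix (Fin d) (Fin d) ℂ} (hA : A.PosDef) {t : ℝ}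
    (ht : t ∈ spectrum ℝ A) : 0 < t := by
  rw [hA.isHermitian.spectrum_real_eq_range_eigenvalues] at ht
  obtain ⟨k, rfl⟩ := ht
  exact hA.eigenvalues_pos k

lemma mpow_zero {d : ℕ} {A : Matrix (Fin d) (Fin d) ℂ} (hA : A.PosDef) : mpow A 0 = 1 := by
  have hsa : IsSelfAdjoint A := hA.isHermitian
  rw [mpow, matFun_eq_cfc hA.isHermitian, ← cfc_const_one ℝ A]
  exact cfc_congr fun t ht => by simp [(spectrum_pos hA ht).ne']

lemma mpow_one {d : ℕ} {A : Matrix (Fin d) (Fin d) ℂ} (hA : A.IsHermitian) : mpow A 1 = A := by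
  have hsa : IsSelfAdjoint A := hA
  rw [mpow, matFun_eq_cfc hA]
  conv_rhs => rw [← cfc_id ℝ A]
  exact cfc_congr fun t _ => by by_cases h : t = 0 <;> simp [h]

lemma matFun_mul_log {d : ℕ} {A : Matrix (Fin d) (Fin d) ℂ} (hA : A.IsHermitian) :
    matFun (fun t => t * Real.log t) A = A * mlog A := by
  have hsa : IsSelfAdjoint A := hA
  have hfin := A.finite_real_spectrum
  rw [mlog, matFun_eq_cfc hA, matFun_eq_cfc hA,
    cfc_mul (fun t => t) Real.log A continuousOn_id (hfin.continuousOn _), cfc_id' ℝ A]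

/-- Derivative of `p ↦ A ^ p`, entrywise. -/
lemma hasDerivAt_mpow_apply {d : ℕ} {A : Matrix (Fin d) (Fin d) ℂ} (hA : A.PosDef) (p : ℝ)
    (i j : Fin d) :
    HasDerivAt (fun q => mpow A q i j) (matFun (fun t => t ^ p * Real.log t) A i j) p := by
  refine hasDerivAt_matFun_apply hA.isHermitian (f := fun q t => if t = 0 then 0 else t ^ q)
    (fun k => ?_) i j
  have hk := hA.eigenvalues_pos k
  simpa only [if_neg hk.ne'] using Real.hasStrictDerivAt_const_rpow hk p |>.hasDerivAt

/-- Product rule for the real part of the trace of a product of matrices. -/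
lemma hasDerivAt_reTr_mul {ι : Type} [Fintype ι] {A B : ℝ → Matrix ι ι ℂ} {A' B' : Matrix ι ι ℂ}
    {s : ℝ} (hA : ∀ i j, HasDerivAt (fun u => A u i j) (A' i j) s)
    (hB : ∀ i j, HasDerivAt (fun u => B u i j) (B' i j) s) :
    HasDerivAt (fun u => reTr (A u * B u)) (reTr (A' * B s + A s * B')) s := by
  have h : HasDerivAt (fun u => (A u * B u).trace) (A' * B s + A s * B').trace s := by
    simp only [Matrix.trace, Matrix.diag_apply, Matrix.add_apply, Matrix.mul_apply,
      ← Finset.sum_add_distrib]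
    exact HasDerivAt.fun_sum fun i _ => HasDerivAt.fun_sum fun j _ => (hA i j).mul (hB j i)
  exact Complex.reCLM.hasFDerivAt.comp_hasDerivAt s h

lemma hasDerivAt_reTr_mpow_mul_mpow {d : ℕ} {ρ σ : Matrix (Fin d) (Fin d) ℂ} (hρ : ρ.PosDef)
    (hσ : σ.PosDef) :
    HasDerivAt (fun s => reTr (mpow ρ (1 - s) * mpow σ s)) (-qD ρ σ) 0 := by
  have hA : ∀ i j, HasDerivAt (fun s : ℝ => mpow ρ (1 - s) i j) ((-(ρ * mlog ρ)) i j) 0 := by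
    intro i j
    have h := hasDerivAt_mpow_apply hρ (1 - 0) i j
    have h1 := h.scomp (0 : ℝ) ((hasDerivAt_id (0 : ℝ)).const_sub 1)
    simpa [Function.comp_def, matFun_mul_log hρ.isHermitian] using h1
  have hB : ∀ i j, HasDerivAt (fun s : ℝ => mpow σ s i j) (mlog σ i j) 0 := by
    intro i j
    simpa [mlog] using hasDerivAt_mpow_apply hσ 0 i j
  convert hasDerivAt_reTr_mul hA hB using 1
  simp [qD, reTr, mpow_zero hσ, mpow_one hρ.isHermitian, mul_sub]
  ring

/-- **First derivative of the modified auxiliary function `Ẽ₀` at `s = 0`.** -/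
theorem E0Tilde_hasDerivAt_zero
    {X : Type} [Fintype X] {d : ℕ}
    (W : X → Matrix (Fin d) (Fin d) ℂ) (hW : ∀ x, (W x).PosDef ∧ (W x).trace = 1)
    (σ : Matrix (Fin d) (Fin d) ℂ) (hσ : σ.PosDef ∧ σ.trace = 1)
    (P : X → ℝ) (hP : IsProbDist P) :
    HasDerivAt (fun s => E0Tilde W s P σ) (∑ x, P x * qD (W x) σ) 0 := by
  have hsum : HasDerivAt (fun s => ∑ x, P x * reTr (mpow (W x) (1 - s) * mpow σ s))
      (∑ x, P x * -qD (W x) σ) 0 :=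
    HasDerivAt.fun_sum fun x _ =>
      (hasDerivAt_reTr_mpow_mul_mpow (hW x).1 hσ.1).const_mul (P x)
  have hone : ∑ x, P x * reTr (mpow (W x) (1 - 0) * mpow σ 0) = 1 := by
    simp [reTr, mpow_zero hσ.1, mpow_one (hW _).1.isHermitian, (hW _).2, hP.2]
  have hlog := (hsum.log (by rw [hone]; exact one_ne_zero)).fun_neg
  rw [hone] at hlog
  simpa [E0Tilde] using hlog

end MDQ
end
end

section
/- Second derivative of the modified auxiliary function Ẽ_0 at s = 0: Let W be a classical-quantum channel with finite input alphabet X whose outputs W_x are positive definite density operators on ℂ^d, let σ be a positive definite density operator on ℂ^d, and let P be a probability distribution on X. Then the function s ↦ Ẽ_0(s,P,σ) := −log Σ_{x∈X} P(x)·Tr[W_x^{1−s} σ^s] is twice differentiable at s = 0 and its second derivative there equals −( Σ_{x∈X} P(x)·Tr[W_x(log W_x − log σ)²] − (Σ_{x∈X} P(x)·D(W_x‖σ))² ), i.e. minus the variance V(P∘W ‖ P⊗σ). -/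
open scoped BigOperators ComplexOrder
open Filter

noncomputable section

namespace MDQ

lemma matFun_of_isHermitian {d : ℕ} {A : Matrix (Fin d) (Fin d) ℂ} (hA : A.IsHermitian)
    (f : ℝ → ℝ) : matFun f A = hA.cfc f := by
  simp [matFun, hA]

lemma matFun_mul {d : ℕ} {A : Matrix (Fin d) (Fin d) ℂ} (hA : A.IsHermitian) (f g : ℝ → ℝ) :
    matFun f A * matFun g A = matFun (fun t => f t * g t) A := by
  simp only [matFun_of_isHermitian hA, Matrix.IsHermitian.cfc, ← map_mul,
    Matrix.diagonal_mul_diagonal]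
  congr 2
  ext i
  simp

lemma matFun_id {d : ℕ} {A : Matrix (Fin d) (Fin d) ℂ} (hA : A.IsHermitian) :
    matFun (fun t => t) A = A := by
  rw [matFun_of_isHermitian hA]
  exact hA.spectral_theorem.symm

lemma matFun_one {d : ℕ} {A : Matrix (Fin d) (Fin d) ℂ} (hA : A.IsHermitian) :
    matFun (fun _ => 1) A = 1 := by
  rw [matFun_of_isHermitian hA, Matrix.IsHermitian.cfc]
  simp [Function.comp_def]

/-- The trace pairing of two Hermitian matrices is a weighted sum over pairs of eigenvalues, with
weights (squared overlaps of the eigenvectors) independent of the functions applied. -/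
lemma exists_reTr_matFun_mul_matFun {d : ℕ} {A B : Matrix (Fin d) (Fin d) ℂ}
    (hA : A.IsHermitian) (hB : B.IsHermitian) :
    ∃ c : Fin d → Fin d → ℝ, ∀ f g : ℝ → ℝ, reTr (matFun f A * matFun g B) =
      ∑ i, ∑ j, c i j * (f (hA.eigenvalues i) * g (hB.eigenvalues j)) := by
  set U : Matrix (Fin d) (Fin d) ℂ := hA.eigenvectorUnitary.1
  set V : Matrix (Fin d) (Fin d) ℂ := hB.eigenvectorUnitary.1
  refine ⟨fun i j => Complex.normSq ((star U * V) i j), fun f g => ?_⟩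
  set F : Matrix (Fin d) (Fin d) ℂ := Matrix.diagonal (RCLike.ofReal ∘ f ∘ hA.eigenvalues)
  set G : Matrix (Fin d) (Fin d) ℂ := Matrix.diagonal (RCLike.ofReal ∘ g ∘ hB.eigenvalues)
  have key : (matFun f A * matFun g B).trace =
      ((F * (star U * V)) * (G * star (star U * V))).trace := by
    rw [matFun_of_isHermitian hA, matFun_of_isHermitian hB, Matrix.IsHermitian.cfc,
      Matrix.IsHermitian.cfc, Unitary.conjStarAlgAut_apply, Unitary.conjStarAlgAut_apply]
    change (U * F * star U * (V * G * star V)).trace = _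
    rw [mul_assoc, mul_assoc, Matrix.trace_mul_comm U]
    simp only [mul_assoc, star_mul, star_star]
  rw [reTr, key, Matrix.trace, Complex.re_sum]
  refine Finset.sum_congr rfl fun i _ => ?_
  rw [Matrix.diag_apply, Matrix.mul_apply, Complex.re_sum]
  refine Finset.sum_congr rfl fun j _ => ?_
  rw [Matrix.diagonal_mul, Matrix.diagonal_mul, Matrix.star_apply]
  beta_reduce
  generalize (star U * V) i j = z
  simp [Complex.normSq_apply]
  ring

lemma reTr_add {ι : Type} [Fintype ι] (A B : Matrix ι ι ℂ) :
    reTr (A + B) = reTr A + reTr B := by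
  simp [reTr]

lemma reTr_sub {ι : Type} [Fintype ι] (A B : Matrix ι ι ℂ) :
    reTr (A - B) = reTr A - reTr B := by
  simp [reTr]

lemma reTr_mul_comm {ι : Type} [Fintype ι] (A B : Matrix ι ι ℂ) :
    reTr (A * B) = reTr (B * A) := by
  rw [reTr, reTr, Matrix.trace_mul_comm]

/-- For positive definite `A` and `B`, the trace functionals `Tr[A^(1-s) B^s]` and
`Tr[A (log A - log B)^k]`, `k ≤ 2`, are moments of one finite weighted sum. -/
lemma exists_nussbaum_szkola_weights {d : ℕ} {A B : Matrix (Fin d) (Fin d) ℂ}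
    (hA : A.PosDef) (hB : B.PosDef) :
    ∃ w q : Fin d × Fin d → ℝ,
      (∀ s : ℝ, reTr (mpow A (1 - s) * mpow B s) = ∑ k, w k * Real.exp (s * q k)) ∧
      reTr A = ∑ k, w k ∧
      qD A B = -∑ k, w k * q k ∧
      reTr (A * (mlog A - mlog B) ^ 2) = ∑ k, w k * q k ^ 2 := by
  have hA' := hA.isHermitian
  have hB' := hB.isHermitian
  obtain ⟨c, hc⟩ := exists_reTr_matFun_mul_matFun hA' hB'
  have ha := hA.eigenvalues_pos
  have hb := hB.eigenvalues_pos
  have hAlog : A * mlog A = matFun (fun t => t * Real.log t) A := by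
    rw [mlog, ← matFun_mul hA', matFun_id hA']
  have hone : ∀ f : ℝ → ℝ, reTr (matFun f A) =
      ∑ i, ∑ j, c i j * (f (hA'.eigenvalues i) * 1) := fun f => by
    rw [← hc f fun _ => 1, matFun_one hB', mul_one]
  refine ⟨fun k => c k.1 k.2 * hA'.eigenvalues k.1,
    fun k => Real.log (hB'.eigenvalues k.2) - Real.log (hA'.eigenvalues k.1), fun s => ?_, ?_, ?_,
    ?_⟩
  · rw [mpow, mpow, hc, Fintype.sum_prod_type]
    refine Finset.sum_congr rfl fun i _ => Finset.sum_congr rfl fun j _ => ?_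
    dsimp only
    rw [if_neg (ha i).ne', if_neg (hb j).ne', mul_assoc, Real.rpow_def_of_pos (ha i),
      Real.rpow_def_of_pos (hb j), ← Real.exp_add]
    nth_rw 2 [← Real.exp_log (ha i)]
    rw [← Real.exp_add]
    ring_nf
  · conv_lhs => rw [← matFun_id hA']
    rw [hone, Fintype.sum_prod_type]
    simp
  · have h2 : reTr (A * mlog B) = reTr (matFun (fun t => t) A * matFun Real.log B) := by
      rw [matFun_id hA', mlog]
    rw [qD, mul_sub, reTr_sub, h2, hAlog, hone, hc, Fintype.sum_prod_type]
    simp only [← Finset.sum_sub_distrib, ← Finset.sum_neg_distrib]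
    refine Finset.sum_congr rfl fun i _ => Finset.sum_congr rfl fun j _ => ?_
    ring
  · have hexp : A * (mlog A - mlog B) ^ 2 = A * mlog A * mlog A - A * mlog A * mlog B
        - A * mlog B * mlog A + A * (mlog B * mlog B) := by
      noncomm_ring
    have h3 : reTr (A * mlog B * mlog A) = reTr (A * mlog A * mlog B) := by
      have hcomm : mlog A * A = A * mlog A := by
        have h := matFun_mul hA' Real.log fun t => t
        rw [matFun_id hA'] at h
        simp only [mul_comm (Real.log _)] at h
        rw [hAlog, mlog, h]
      rw [reTr_mul_comm, ← mul_assoc, hcomm]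
    have h1 : A * mlog A * mlog A = matFun (fun t => t * Real.log t * Real.log t) A := by
      rw [hAlog, mlog, matFun_mul hA']
    have h4 : reTr (A * (mlog B * mlog B)) =
        reTr (matFun (fun t => t) A * matFun (fun t => Real.log t * Real.log t) B) := by
      rw [matFun_id hA', mlog, matFun_mul hB']
    rw [hexp, reTr_add, reTr_sub, reTr_sub, h3, h1, h4, hAlog, hone, mlog, hc, hc,
      Fintype.sum_prod_type]
    simp only [← Finset.sum_sub_distrib, ← Finset.sum_add_distrib]
    refine Finset.sum_congr rfl fun i _ => Finset.sum_congr rfl fun j _ => ?_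
    ring

/-- The second derivative at `0` of a cumulant generating function is the variance. -/
lemma hasDerivAt_deriv_neg_log_sum_exp {ι : Type} [Fintype ι] (w q : ι → ℝ)
    (hw : ∑ k, w k = 1) :
    HasDerivAt (deriv fun s : ℝ => -Real.log (∑ k, w k * Real.exp (s * q k)))
      (-(∑ k, w k * q k ^ 2 - (∑ k, w k * q k) ^ 2)) 0 := by
  have hd : ∀ (v : ι → ℝ) (s : ℝ), HasDerivAt (fun s : ℝ => ∑ k, v k * Real.exp (s * q k))
      (∑ k, v k * q k * Real.exp (s * q k)) s := fun v s => by
    refine HasDerivAt.fun_sum fun k _ => ?_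
    refine (((hasDerivAt_mul_const (q k)).exp).const_mul (v k)).congr_deriv ?_
    ring
  have hne : ∑ k, w k * Real.exp (0 * q k) ≠ 0 := by simp [hw]
  have hev : (deriv fun s : ℝ => -Real.log (∑ k, w k * Real.exp (s * q k))) =ᶠ[nhds 0]
      fun s => -((∑ k, w k * q k * Real.exp (s * q k)) / ∑ k, w k * Real.exp (s * q k)) := by
    filter_upwards [(hd w 0).continuousAt.eventually_ne hne] with s hs
    exact ((hd w s).log hs).neg.deriv
  refine HasDerivAt.congr_of_eventuallyEq ?_ hev
  refine ((hd (fun k => w k * q k) 0).fun_div (hd w 0) hne).fun_neg.congr_deriv ?_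
  simp [hw]
  ring_nf

/-- **Second derivative of the modified auxiliary function `Ẽ₀` at `s = 0`.** -/
theorem E0Tilde_second_deriv_zero
    {X : Type} [Fintype X] {d : ℕ}
    (W : X → Matrix (Fin d) (Fin d) ℂ) (hW : ∀ x, (W x).PosDef ∧ (W x).trace = 1)
    (σ : Matrix (Fin d) (Fin d) ℂ) (hσ : σ.PosDef ∧ σ.trace = 1)
    (P : X → ℝ) (hP : IsProbDist P) :
    HasDerivAt (deriv (fun s => E0Tilde W s P σ))
      (-((∑ x, P x * reTr (W x * (mlog (W x) - mlog σ) ^ 2)) -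
          (∑ x, P x * qD (W x) σ) ^ 2)) 0 := by
  choose w q hpow htr hD hsq using
    fun x => exists_nussbaum_szkola_weights (hW x).1 hσ.1
  have hmoment : ∀ F : X → Fin d × Fin d → ℝ,
      ∑ k : X × (Fin d × Fin d), P k.1 * F k.1 k.2 = ∑ x, P x * ∑ k, F x k := fun F => by
    simp only [Fintype.sum_prod_type (α₁ := X), Finset.mul_sum]
  have hone : ∑ k : X × (Fin d × Fin d), P k.1 * w k.1 k.2 = 1 := by
    rw [hmoment, ← hP.2]
    refine Finset.sum_congr rfl fun x _ => ?_
    rw [← htr, reTr, (hW x).2, Complex.one_re, mul_one]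
  convert hasDerivAt_deriv_neg_log_sum_exp (fun k : X × (Fin d × Fin d) => P k.1 * w k.1 k.2)
    (fun k => q k.1 k.2) hone using 1
  · congr 1
    ext s
    simp only [E0Tilde, hpow, mul_assoc]
    rw [hmoment fun x k => w x k * Real.exp (s * q x k)]
  · simp only [hsq, hD, mul_assoc, mul_neg, Finset.sum_neg_distrib, neg_sq]
    rw [hmoment fun x k => w x k * q x k ^ 2, hmoment fun x k => w x k * q x k]

end MDQ
end
end

section
/- Concavity of the exponent function E_h: Let W be a classical-quantum channel with finite input alphabet X and outputs density operators on ℂ^d, let σ be a positive definite density operator on ℂ^d, and let P be a probability distribution on X. Then the function s ↦ E_h(s,P,σ) := −(1+s)·Σ_{x:P(x)>0} P(x)·log Tr[W_x^{1/(1+s)} σ^{s/(1+s)}] is concave on [0, +∞). -/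
open scoped BigOperators ComplexOrder
open Filter

noncomputable section

namespace MDQ

/-- The log-sum-exp function is convex. -/
theorem convexOn_log_sum_exp {ι : Type*} [Fintype ι] (w x : ι → ℝ) (hw : ∀ i, 0 ≤ w i) :
    ConvexOn ℝ Set.univ fun t : ℝ => Real.log (∑ i, w i * Real.exp (t * x i)) := by
  set S : ℝ → ℝ := fun t => ∑ i, w i * Real.exp (t * x i) with hS
  by_cases h0 : ∀ i, w i = 0
  · simpa [h0] using convexOn_const (0 : ℝ) (convex_univ (𝕜 := ℝ) (E := ℝ))
  push Not at h0
  obtain ⟨k, hk⟩ := h0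
  have hpos : ∀ t, 0 < S t := fun t =>
    Finset.sum_pos' (fun i _ => mul_nonneg (hw i) (Real.exp_pos _).le)
      ⟨k, Finset.mem_univ k, mul_pos (lt_of_le_of_ne (hw k) hk.symm) (Real.exp_pos _)⟩
  refine ⟨convex_univ, fun u _ v _ a b ha hb hab => ?_⟩
  simp only [smul_eq_mul]
  change Real.log (S (a * u + b * v)) ≤ a * Real.log (S u) + b * Real.log (S v)
  have normalized : ∀ t, ∑ i, w i * Real.exp (t * x i - Real.log (S t)) = 1 := fun t => by
    simp only [Real.exp_sub, Real.exp_log (hpos t), ← mul_div_assoc, ← Finset.sum_div]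
    exact div_self (hpos t).ne'
  have key : ∑ i, w i * Real.exp ((a * u + b * v) * x i -
      (a * Real.log (S u) + b * Real.log (S v))) ≤ 1 := by
    calc _ ≤ ∑ i, w i * (a * Real.exp (u * x i - Real.log (S u)) +
          b * Real.exp (v * x i - Real.log (S v))) := by
          refine Finset.sum_le_sum fun i _ => mul_le_mul_of_nonneg_left ?_ (hw i)
          have := convexOn_exp.2 (Set.mem_univ (u * x i - Real.log (S u)))
            (Set.mem_univ (v * x i - Real.log (S v))) ha hb hab
          simp only [smul_eq_mul] at this
          convert this using 2
          ring
      _ = a * ∑ i, w i * Real.exp (u * x i - Real.log (S u)) +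
          b * ∑ i, w i * Real.exp (v * x i - Real.log (S v)) := by
          simp only [Finset.mul_sum, ← Finset.sum_add_distrib]
          exact Finset.sum_congr rfl fun i _ => by ring
      _ = 1 := by rw [normalized, normalized, mul_one, mul_one, hab]
  simp only [Real.exp_sub, ← mul_div_assoc, ← Finset.sum_div] at key
  rw [div_le_one (Real.exp_pos _)] at key
  exact (Real.log_le_iff_le_exp (hpos _)).2 key

/-- The perspective `y ↦ y * f (1 / y)` of a convex function is convex on `y > 0`. -/
theorem _root_.ConvexOn.perspective_inv {f : ℝ → ℝ} (hf : ConvexOn ℝ Set.univ f) :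
    ConvexOn ℝ (Set.Ioi 0) fun y => y * f (1 / y) := by
  refine ⟨convex_Ioi 0, fun u hu v hv a b ha hb hab => ?_⟩
  have hy : 0 < a * u + b * v := by simpa using convex_Ioi (0 : ℝ) hu hv ha hb hab
  have hu : 0 < u := hu
  have hv : 0 < v := hv
  have h := hf.2 (Set.mem_univ (1 / u)) (Set.mem_univ (1 / v))
    (show 0 ≤ a * u / (a * u + b * v) by positivity)
    (show 0 ≤ b * v / (a * u + b * v) by positivity) (by field_simp)
  simp only [smul_eq_mul] at h ⊢
  have hpt : a * u / (a * u + b * v) * (1 / u) + b * v / (a * u + b * v) * (1 / v) =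
      1 / (a * u + b * v) := by
    field_simp
    exact hab
  rw [hpt] at h
  calc _ ≤ (a * u + b * v) * (a * u / (a * u + b * v) * f (1 / u) +
        b * v / (a * u + b * v) * f (1 / v)) := mul_le_mul_of_nonneg_left h hy.le
    _ = _ := by field_simp

/-- The trace of a product of two functions of Hermitian matrices, in terms of the eigenvalues
and of the overlaps of the eigenvectors. -/
theorem reTr_cfc_mul_cfc {d : ℕ} {A B : Matrix (Fin d) (Fin d) ℂ} (hA : A.IsHermitian)
    (hB : B.IsHermitian) (f g : ℝ → ℝ) :
    reTr (hA.cfc f * hB.cfc g) = ∑ i, ∑ j, f (hA.eigenvalues i) * g (hB.eigenvalues j) *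
      Complex.normSq ((star (hA.eigenvectorUnitary : Matrix (Fin d) (Fin d) ℂ) *
        (hB.eigenvectorUnitary : Matrix (Fin d) (Fin d) ℂ)) i j) := by
  obtain ⟨U, hU⟩ : ∃ U : Matrix (Fin d) (Fin d) ℂ,
      (hA.eigenvectorUnitary : Matrix (Fin d) (Fin d) ℂ) = U := ⟨_, rfl⟩
  obtain ⟨V, hV⟩ : ∃ V : Matrix (Fin d) (Fin d) ℂ,
      (hB.eigenvectorUnitary : Matrix (Fin d) (Fin d) ℂ) = V := ⟨_, rfl⟩
  rw [hU, hV]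
  set D : Matrix (Fin d) (Fin d) ℂ :=
    Matrix.diagonal (fun i => (f (hA.eigenvalues i) : ℂ)) with hD
  set E : Matrix (Fin d) (Fin d) ℂ :=
    Matrix.diagonal (fun i => (g (hB.eigenvalues i) : ℂ)) with hE
  have h1 : hA.cfc f = U * D * star U := by
    simp [Matrix.IsHermitian.cfc, Unitary.conjStarAlgAut_apply, hU, hD, Function.comp_def]
  have h2 : hB.cfc g = V * E * star V := by
    simp [Matrix.IsHermitian.cfc, Unitary.conjStarAlgAut_apply, hV, hE, Function.comp_def]
  have h3 : (hA.cfc f * hB.cfc g).trace =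
      (D * ((star U * V) * (E * star (star U * V)))).trace := by
    rw [h1, h2, star_mul, star_star, Matrix.mul_assoc, Matrix.mul_assoc, Matrix.trace_mul_comm]
    simp only [Matrix.mul_assoc]
  rw [reTr, h3, Matrix.trace, Complex.re_sum]
  refine Finset.sum_congr rfl fun i _ => ?_
  rw [Matrix.diag_apply, hD, Matrix.diagonal_mul, Matrix.mul_apply, Finset.mul_sum, Complex.re_sum]
  refine Finset.sum_congr rfl fun j _ => ?_
  rw [hE, Matrix.diagonal_mul, Matrix.star_apply]
  generalize (star U * V) i j = z
  rw [show (f (hA.eigenvalues i) : ℂ) * (z * (g (hB.eigenvalues j) * star z)) =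
    ((f (hA.eigenvalues i) * g (hB.eigenvalues j) * Complex.normSq z : ℝ) : ℂ) by
      push_cast [Complex.normSq_eq_conj_mul_self]
      simp only [Complex.star_def]
      ring, Complex.ofReal_re]

/-- The Petz quantity `Tr[ρ ^ t * σ ^ (1 - t)]` is a nonnegative combination of exponentials
in `t`. -/
theorem exists_reTr_mpow_mul_mpow_eq_sum_exp {d : ℕ} {ρ σ : Matrix (Fin d) (Fin d) ℂ}
    (hρ : ρ.PosSemidef) (hσ : σ.PosDef) :
    ∃ w x : Fin d × Fin d → ℝ, (∀ k, 0 ≤ w k) ∧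
      ∀ t : ℝ, reTr (mpow ρ t * mpow σ (1 - t)) = ∑ k, w k * Real.exp (t * x k) := by
  refine ⟨fun k => if hρ.1.eigenvalues k.1 = 0 then 0 else hσ.1.eigenvalues k.2 *
      Complex.normSq ((star (hρ.1.eigenvectorUnitary : Matrix (Fin d) (Fin d) ℂ) *
        (hσ.1.eigenvectorUnitary : Matrix (Fin d) (Fin d) ℂ)) k.1 k.2),
    fun k => Real.log (hρ.1.eigenvalues k.1) - Real.log (hσ.1.eigenvalues k.2),
    fun k => ?_, fun t => ?_⟩
  · dsimp only
    split_ifs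
    · exact le_rfl
    · exact mul_nonneg (hσ.eigenvalues_pos _).le (Complex.normSq_nonneg _)
  · rw [mpow, mpow, matFun, matFun, dif_pos hρ.1, dif_pos hσ.1, reTr_cfc_mul_cfc,
      Fintype.sum_prod_type]
    refine Finset.sum_congr rfl fun i _ => Finset.sum_congr rfl fun j _ => ?_
    have hb := hσ.eigenvalues_pos j
    dsimp only
    rw [if_neg hb.ne']
    split_ifs with ha
    · simp
    · have ha : 0 < hρ.1.eigenvalues i := lt_of_le_of_ne (hρ.eigenvalues_nonneg i) (Ne.symm ha)
      have hexp : hρ.1.eigenvalues i ^ t * hσ.1.eigenvalues j ^ (1 - t) = hσ.1.eigenvalues j *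
          Real.exp (t * (Real.log (hρ.1.eigenvalues i) - Real.log (hσ.1.eigenvalues j))) := by
        rw [Real.rpow_def_of_pos ha, Real.rpow_sub hb, Real.rpow_one, Real.rpow_def_of_pos hb,
          mul_sub, Real.exp_sub, mul_comm t, mul_comm t]
        ring
      rw [hexp]
      ring

/-- **Concavity of the exponent function `E_h`.** -/
theorem Eh_concaveOn
    {X : Type} [Fintype X] {d : ℕ}
    (W : X → Matrix (Fin d) (Fin d) ℂ) (hW : ∀ x, IsDensity (W x))
    (σ : Matrix (Fin d) (Fin d) ℂ) (hσ : σ.PosDef ∧ σ.trace = 1)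
    (P : X → ℝ) (hP : IsProbDist P) :
    ConcaveOn ℝ (Set.Ici 0) (fun s => Eh W s P σ) := by
  refine ⟨convex_Ici 0, fun s hs t ht a b ha hb hab => ?_⟩
  have hs : 0 ≤ s := hs
  have ht : 0 ≤ t := ht
  simp only [Eh, smul_eq_mul, neg_mul, mul_neg, ← neg_add]
  refine neg_le_neg ?_
  simp only [Finset.mul_sum, ← Finset.sum_add_distrib]
  refine Finset.sum_le_sum fun x _ => ?_
  obtain ⟨w, l, hw, h⟩ := exists_reTr_mpow_mul_mpow_eq_sum_exp (hW x).1 hσ.1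
  have hc := ((convexOn_log_sum_exp w l hw).perspective_inv).2
    (show 1 + s ∈ Set.Ioi (0 : ℝ) by simp only [Set.mem_Ioi]; positivity)
    (show 1 + t ∈ Set.Ioi (0 : ℝ) by simp only [Set.mem_Ioi]; positivity) ha hb hab
  have hy : a * (1 + s) + b * (1 + t) = 1 + (a * s + b * t) := by linear_combination hab
  have hsub : ∀ u : ℝ, 0 ≤ u → u / (1 + u) = 1 - 1 / (1 + u) := fun u hu => by
    field_simp
    ring
  simp only [smul_eq_mul, hy, ← h] at hc
  rw [hsub s hs, hsub t ht, hsub _ (by positivity)]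
  nlinarith [mul_le_mul_of_nonneg_left hc (hP.1 x)]

end MDQ
end
end
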